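/- arXiv:1104.4412 — 3 statements merged into one kernel-verified Lean document; each statement's English description precedes it below -/
import Mathlib

section
/- Let p : ℕ → [0,1] be such that n·p(n)·(1−p(n))/(log n)² → ∞. Then for all sufficiently large n, every p(n)-pseudorandom graph G on n vertices satisfies: (i) for any vertex x of G, G contains a matching of size ⌊n/2⌋ covering x; and (ii) if u is an integer with 0 ≤ u ≤ 4√(np(1−p)), u ≠ 1, and G is 2u-jumping, and G' is formed from G by adding u new edges at the vertex x₀ of minimum degree of G, and additionally removing an arbitrary matching M if δ(G) + u is odd, then, letting r be the greatest even integer at most δ(G) + u, the graph G' has an r-regular spanning subgraph. -/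
open scoped Classical
open SimpleGraph

namespace EDHC

/-- Degree of a vertex (as cardinality of its neighbour set). -/
noncomputable def deg {V : Type} (G : SimpleGraph V) (v : V) : ℕ := (G.neighborSet v).ncard

/-- Minimum degree. -/
noncomputable def minDeg {V : Type} (G : SimpleGraph V) : ℕ := sInf (Set.range (deg G))

/-- Maximum degree. -/
noncomputable def maxDeg {V : Type} (G : SimpleGraph V) : ℕ := sSup (Set.range (deg G))

/-- Number of edges of `G` with both endpoints in `S`. -/
noncomputable def eIn {V : Type} (G : SimpleGraph V) (S : Set V) : ℕ :=
  {e ∈ G.edgeSet | ∀ v ∈ e, v ∈ S}.ncard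

/-- Number of edges of `G` with one endpoint in `S` and the other in `T`. -/
noncomputable def eBtw {V : Type} (G : SimpleGraph V) (S T : Set V) : ℕ :=
  {e ∈ G.edgeSet | ∃ a ∈ S, ∃ b ∈ T, e = s(a, b)}.ncard

/-- `G` is `(p, β)`-jumbled. -/
def IsJumbled {V : Type} (G : SimpleGraph V) (p β : ℝ) : Prop :=
  ∀ S : Set V, |(eIn G S : ℝ) - p * ((S.ncard : ℝ) * ((S.ncard : ℝ) - 1) / 2)| ≤ β * S.ncard

/-- `G` is strongly `2`-jumping. -/
def StronglyTwoJumping (n : ℕ) (G : SimpleGraph (Fin n)) : Prop :=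
  ∀ T : Set (Fin n), T.Nonempty →
    (∑ v ∈ (Set.toFinite T).toFinset, (deg G v : ℝ)) / (T.ncard : ℝ) ≥
      (minDeg G : ℝ) + min ((T.ncard : ℝ) - 1) ((Real.log n) ^ 2)

/-- `G` is `p`-pseudorandom. -/
def IsPseudorandom (n : ℕ) (G : SimpleGraph (Fin n)) (p : ℝ) : Prop :=
  IsJumbled G p (2 * Real.sqrt (n * p * (1 - p))) ∧
  (∀ S T : Set (Fin n), Disjoint S T →
    ((1 / (S.ncard : ℝ) + 1 / (T.ncard : ℝ)) * Real.log n / p ≥ 7 / 2 →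
      (eBtw G S T : ℝ) ≤ 2 * ((S.ncard : ℝ) + (T.ncard : ℝ)) * Real.log n) ∧
    ((1 / (S.ncard : ℝ) + 1 / (T.ncard : ℝ)) * Real.log n / p ≤ 7 / 2 →
      (eBtw G S T : ℝ) ≤ 7 * (S.ncard : ℝ) * (T.ncard : ℝ) * p)) ∧
  (∀ S : Set (Fin n),
    (Real.log n / ((S.ncard : ℝ) * p) ≥ 7 / 4 → (eIn G S : ℝ) ≤ 2 * (S.ncard : ℝ) * Real.log n) ∧
    (Real.log n / ((S.ncard : ℝ) * p) ≤ 7 / 4 → (eIn G S : ℝ) ≤ 7 * (S.ncard : ℝ) ^ 2 * p / 2)) ∧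
  ((n : ℝ) * p - 2 * Real.sqrt ((n : ℝ) * p * Real.log n) ≤ (minDeg G : ℝ) ∧
    (minDeg G : ℝ) ≤ (n : ℝ) * p - 200 * Real.sqrt ((n : ℝ) * p * (1 - p)) ∧
    (maxDeg G : ℝ) ≤ (n : ℝ) * p + 2 * Real.sqrt ((n : ℝ) * p * Real.log n)) ∧
  StronglyTwoJumping n G

/-- `G` is `u`-jumping. -/
def IsJumping (n : ℕ) (G : SimpleGraph (Fin n)) (u : ℝ) : Prop :=
  ∃ x₀ : Fin n, deg G x₀ = minDeg G ∧
    ∀ x : Fin n, x ≠ x₀ → (deg G x : ℝ) ≥ (minDeg G : ℝ) + u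

/-- `C` is a Hamilton cycle (on the whole vertex set `Fin n`). -/
def IsHamCycle {n : ℕ} (C : SimpleGraph (Fin n)) : Prop :=
  ∃ (v : Fin n) (w : C.Walk v v), w.IsHamiltonianCycle ∧ C.edgeSet = {e | e ∈ w.edges}

/-- `G` has property `H`. -/
def HasPropertyH (n : ℕ) (G : SimpleGraph (Fin n)) : Prop :=
  ∃ HC : Fin (minDeg G / 2) → SimpleGraph (Fin n),
    (∀ i, HC i ≤ G ∧ IsHamCycle (HC i)) ∧
    (∀ i j, i ≠ j → Disjoint (HC i).edgeSet (HC j).edgeSet) ∧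
    (Odd (minDeg G) →
      ∃ M : SimpleGraph (Fin n), M ≤ G ∧ (∀ v, deg M v ≤ 1) ∧
        M.edgeSet.ncard = n / 2 ∧ ∀ i, Disjoint M.edgeSet (HC i).edgeSet)

/-- Probability of the event `A` under the binomial random graph `G_{n,p}`. -/
noncomputable def gnpProb (n : ℕ) (p : ℝ) (A : SimpleGraph (Fin n) → Prop) : ℝ :=
  ∑ G : SimpleGraph (Fin n),
    if A G then p ^ G.edgeSet.ncard * (1 - p) ^ (n.choose 2 - G.edgeSet.ncard) else 0


/-- Number of cycles of a 2-regular graph = number of connected components. -/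
noncomputable def numCycles {V : Type} (F : SimpleGraph V) : ℕ := Nat.card F.ConnectedComponent

/-- `N` is a perfect matching on the whole vertex set. -/
def IsPerfectMatchingGraph {n : ℕ} (N : SimpleGraph (Fin n)) : Prop :=
  ∀ v, ((N.neighborSet v).ncard) = 1

/-- `N` is a perfect pseudomatching: one vertex of degree 2, all others of degree 1. -/
def IsPerfectPseudomatching {n : ℕ} (N : SimpleGraph (Fin n)) : Prop :=
  ∃ w, ((N.neighborSet w).ncard) = 2 ∧ ∀ v, v ≠ w → ((N.neighborSet v).ncard) = 1

/-- A set of edges forms a matching (no two distinct edges share a vertex). -/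
def IsMatchingSet {n : ℕ} (E : Set (Sym2 (Fin n))) : Prop :=
  ∀ e ∈ E, ∀ f ∈ E, e ≠ f → ∀ v : Fin n, v ∈ e → v ∉ f

/-- Number of cycles (orbits, including fixed points) of a permutation. -/
noncomputable def cycleCount {α : Type} (σ : Equiv.Perm α) : ℕ :=
  Nat.card (Quotient (⟨σ.SameCycle,
    ⟨fun x => Equiv.Perm.SameCycle.refl σ x, fun h => h.symm, fun h h' => h.trans h'⟩⟩ : Setoid α))

/-- Edges of the bipartite graph given by the relation `R` between `S` and `T`. -/
noncomputable def eBip {n : ℕ} (R : Fin n → Fin n → Prop) (S T : Set (Fin n)) : ℕ :=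
  {q : Fin n × Fin n | q.1 ∈ S ∧ q.2 ∈ T ∧ R q.1 q.2}.ncard

/-- One rotation of a path (represented as a list of vertices), with new edge from `H`
and pivot in `Q`. -/
def RotStep {V : Type} (H : SimpleGraph V) (Q : Set V) (l l' : List V) : Prop :=
  ∃ (x : V) (a : List V) (p : V) (b : List V),
    l = (x :: a) ++ p :: b ∧ l' = (x :: a).reverse ++ p :: b ∧ p ∈ Q ∧ H.Adj x p

/-- `v` is `(H, Q, τ)`-reachable from the path `l`. -/
def ReachableVert {V : Type} (H : SimpleGraph V) (Q : Set V) (τ : ℕ) (l : List V) (v : V) : Prop :=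
  ∃ (k : ℕ) (f : ℕ → List V), k ≤ τ ∧ f 0 = l ∧
    (∀ i < k, RotStep H Q (f i) (f (i + 1))) ∧ (f k).head? = some v

/-- External neighbourhood. -/
def extNbhd {V : Type} (H : SimpleGraph V) (S : Set V) : Set V :=
  (⋃ x ∈ S, H.neighborSet x) \ S

end EDHC

namespace EDHC

/-- `A` is a union of connected components of the graph induced by `F` on `C`. -/
def ClosedIn {V : Type} (F : SimpleGraph V) (C A : Finset V) : Prop :=
  A ⊆ C ∧ ∀ a ∈ A, ∀ b ∈ C, F.Adj a b → b ∈ A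

/-- Tutte's theorem, where the barrier is tested against sets meeting all odd components. -/
theorem exists_isPerfectMatching_or_barrier {W : Type} [Fintype W] [DecidableEq W]
    (H : SimpleGraph W) (heven : Even (Fintype.card W)) :
    (∃ M : H.Subgraph, M.IsPerfectMatching) ∨
      ∃ U : Finset W, ∀ P : Finset W,
        (∀ K : Finset W, ClosedIn H Uᶜ K → K.Nonempty →
          (∀ K' ⊆ K, ClosedIn H Uᶜ K' → K'.Nonempty → K' = K) → Odd K.card → ∃ x ∈ K, x ∈ P) →
        U.card + 2 ≤ P.card := by
  by_contra! hcon
  obtain ⟨hM, hU⟩ := hcon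
  have h1 : ¬ ∀ u, ¬ H.IsTutteViolator u := fun hu => by
    obtain ⟨M, hM'⟩ := tutte.2 hu
    exact hM M hM'
  push Not at h1
  obtain ⟨u, hu⟩ := h1
  obtain ⟨P, hP, hlt⟩ := hU u.toFinset
  unfold IsTutteViolator at hu
  set J := ((⊤ : H.Subgraph).deleteVerts u) with hJ
  have hverts : ∀ x, x ∈ J.verts ↔ x ∉ u := by intro x; simp [hJ]
  have hadj : ∀ x y : J.verts, J.coe.Adj x y ↔ H.Adj x y := by
    rintro ⟨x, hx⟩ ⟨y, hy⟩
    have h1 := (hverts x).1 hx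
    have h2 := (hverts y).1 hy
    simp [hJ, h1, h2]
  have hpar := odd_ncard_oddComponents (G := J.coe)
  have hcardJ : Nat.card J.verts + u.ncard = Fintype.card W := by
    have : J.verts = uᶜ := by ext x; simp [hverts]
    rw [this, Nat.card_coe_set_eq, ← Nat.card_eq_fintype_card, add_comm]
    exact Set.ncard_add_ncard_compl u
  have hle : J.coe.oddComponents.ncard ≤ P.card := by
    have key : ∀ c : J.coe.ConnectedComponent, Odd c.supp.ncard →
        ∃ x ∈ P, ∃ h : x ∈ J.verts, J.coe.connectedComponentMk ⟨x, h⟩ = c := by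
      intro c hc
      suffices hex : ∃ x ∈ (Subtype.val '' c.supp).toFinset, x ∈ P by
        obtain ⟨x, hxK, hxP⟩ := hex
        simp only [Set.mem_toFinset, Set.mem_image] at hxK
        obtain ⟨⟨x, hx⟩, hx2, rfl⟩ := hxK
        exact ⟨x, hxP, hx, hx2⟩
      apply hP
      · refine ⟨?_, ?_⟩
        · intro x hx
          simp only [Set.mem_toFinset, Set.mem_image] at hx
          obtain ⟨⟨x, hx⟩, hx2, rfl⟩ := hx
          simpa using (hverts x).1 hx
        · intro a ha b hb hab
          simp only [Set.mem_toFinset, Set.mem_image] at ha ⊢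
          obtain ⟨⟨x, hx⟩, hx2, rfl⟩ := ha
          have hb' : b ∈ J.verts := (hverts b).2 (by simpa using hb)
          refine ⟨⟨b, hb'⟩, ?_, rfl⟩
          exact ConnectedComponent.mem_supp_of_adj_mem_supp c hx2 ((hadj _ _).2 hab)
      · obtain ⟨x, hx⟩ := c.nonempty_supp
        exact ⟨x, by simpa using hx⟩
      · intro K' hK' hcl hne
        refine Finset.Subset.antisymm hK' ?_
        obtain ⟨x, hx⟩ := hne
        have hxc := hK' hx
        simp only [Set.mem_toFinset, Set.mem_image] at hxc
        obtain ⟨x', hx', rfl⟩ := hxc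
        have step : ∀ y z : J.verts, J.coe.Reachable y z → y.1 ∈ K' → z.1 ∈ K' := by
          rintro y z ⟨w⟩
          induction w with
          | nil => exact id
          | cons hadj' _ ih =>
            intro hy
            refine ih (hcl.2 _ hy _ ?_ ((hadj _ _).1 hadj'))
            simpa using (hverts _).1 (Subtype.prop _)
        intro y hy
        simp only [Set.mem_toFinset, Set.mem_image] at hy
        obtain ⟨y', hy', rfl⟩ := hy
        exact step x' y' (ConnectedComponent.exact (hx'.trans hy'.symm)) hx
      · rw [Set.toFinset_card, ← Nat.card_eq_fintype_card, Nat.card_coe_set_eq,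
          Set.ncard_image_of_injective _ Subtype.val_injective]
        exact hc
    choose f hfP hfv hfc using key
    rw [← Set.ncard_coe_finset]
    refine Set.ncard_le_ncard_of_injOn
      (fun c => if h : Odd c.supp.ncard then f c h else Classical.choice ⟨c.nonempty_supp.some.1⟩)
      ?_ ?_ (Finset.finite_toSet P)
    · intro c hc
      have hc' : Odd c.supp.ncard := hc
      simp only [hc', dif_pos]
      exact hfP c hc'
    · intro c hc d hd hcd
      have hc' : Odd c.supp.ncard := hc
      have hd' : Odd d.supp.ncard := hd
      simp only [hc', hd', dif_pos] at hcd
      rw [← hfc c hc', ← hfc d hd']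
      congr 2
  have hucard : u.toFinset.card = u.ncard := (Set.ncard_eq_toFinset_card' u).symm
  rw [hucard] at hlt
  have h3 : J.coe.oddComponents.ncard = u.ncard + 1 := by omega
  rw [h3] at hpar
  rw [← hcardJ] at heven
  grind

/-- Tutte's gadget: a perfect matching of this graph encodes an `r`-factor of `Γ`. -/
def factorGadget {V : Type} (Γ : SimpleGraph V) (r : ℕ) :
    SimpleGraph ((V × Fin r) ⊕ Γ.Dart) where
  Adj x y := match x, y with
    | .inl _, .inl _ => False
    | .inl a, .inr d => d.fst = a.1
    | .inr d, .inl a => d.fst = a.1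
    | .inr d, .inr d' => d' = d.symm
  symm := ⟨by
    rintro (a | d) (b | d') h
    · exact h
    · exact h
    · exact h
    · simp only at h ⊢
      rw [h, Dart.symm_symm]⟩
  loopless := ⟨by
    rintro (a | d) h
    · exact h
    · exact d.symm_ne h.symm⟩

section Gadget

variable {V : Type} {Γ : SimpleGraph V} {r : ℕ}

@[simp] lemma factorGadget_inl_inl (a b : V × Fin r) :
    ¬ (factorGadget Γ r).Adj (.inl a) (.inl b) := id

@[simp] lemma factorGadget_inl_inr (a : V × Fin r) (d : Γ.Dart) :
    (factorGadget Γ r).Adj (.inl a) (.inr d) ↔ d.fst = a.1 := Iff.rfl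

@[simp] lemma factorGadget_inr_inl (a : V × Fin r) (d : Γ.Dart) :
    (factorGadget Γ r).Adj (.inr d) (.inl a) ↔ d.fst = a.1 := Iff.rfl

@[simp] lemma factorGadget_inr_inr (d d' : Γ.Dart) :
    (factorGadget Γ r).Adj (.inr d) (.inr d') ↔ d' = d.symm := Iff.rfl

lemma exists_factor_of_isPerfectMatching (M : (factorGadget Γ r).Subgraph)
    (hM : M.IsPerfectMatching) : ∃ R ≤ Γ, ∀ v, deg R v = r := by
  rw [Subgraph.isPerfectMatching_iff] at hM
  have huniq : ∀ {x y z}, M.Adj x y → M.Adj x z → y = z := fun h h' => (hM _).unique h h'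
  refine ⟨{ Adj := fun v w => ∃ h : Γ.Adj v w, ∃ i, M.Adj (.inl (v, i)) (.inr ⟨(v, w), h⟩)
            symm := ⟨?_⟩
            loopless := ⟨fun v h => Γ.loopless.irrefl v h.1⟩ }, fun v w h => h.1, fun v => ?_⟩
  · rintro v w ⟨h, i, hi⟩
    refine ⟨h.symm, ?_⟩
    obtain ⟨x, hx, -⟩ := hM (.inr ⟨(w, v), h.symm⟩)
    rcases x with ⟨a, j⟩ | d
    · have := M.adj_sub hx
      simp only [factorGadget_inr_inl] at this
      subst this
      exact ⟨j, hx.symm⟩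
    · have := M.adj_sub hx
      simp only [factorGadget_inr_inr, Dart.symm_mk] at this
      subst this
      exact absurd (huniq hi.symm hx.symm) (by simp)
  · have hp : ∀ i : Fin r, ∃ d : Γ.Dart, M.Adj (.inl (v, i)) (.inr d) ∧ d.fst = v := by
      intro i
      obtain ⟨x, hx, -⟩ := hM (.inl (v, i))
      have := M.adj_sub hx
      rcases x with a | d
      · exact absurd this (factorGadget_inl_inl _ _)
      · exact ⟨d, hx, this⟩
    choose d hd hdv using hp
    have hinj : Function.Injective fun i => (d i).snd := by
      intro i j hij
      have : d i = d j := Dart.ext _ _ (Prod.ext ((hdv i).trans (hdv j).symm) hij)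
      have h1 := (hd i).symm
      rw [this] at h1
      simpa using huniq h1 (hd j).symm
    have hrange : ∀ w, (∃ h : Γ.Adj v w, ∃ i, M.Adj (.inl (v, i)) (.inr ⟨(v, w), h⟩)) ↔
        w ∈ Set.range fun i => (d i).snd := by
      intro w
      constructor
      · rintro ⟨h, i, hi⟩
        have := huniq hi (hd i)
        simp only [Sum.inr.injEq] at this
        exact ⟨i, by simp [← this]⟩
      · rintro ⟨i, rfl⟩
        have hdi : (⟨(v, (d i).snd), hdv i ▸ (d i).adj⟩ : Γ.Dart) = d i :=
          Dart.ext _ _ (Prod.ext (hdv i).symm rfl)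
        exact ⟨hdv i ▸ (d i).adj, i, by rw [hdi]; exact hd i⟩
    unfold deg neighborSet
    simp only [hrange, Set.ofPred_mem_eq]
    rw [← Nat.card_coe_set_eq, Nat.card_range_of_injective hinj, Nat.card_eq_fintype_card,
      Fintype.card_fin]

end Gadget

/-- A sufficient condition for an `r`-factor in the spirit of Tutte's `f`-factor theorem. The graph
`F` describes adjacency after deletion of the part of the barrier lying outside `S ∪ T`. -/
theorem exists_factor_or_barrier {V : Type} [Fintype V] [DecidableEq V] (Γ : SimpleGraph V)
    {r : ℕ} (hr : Even r) :
    (∃ R ≤ Γ, ∀ v, deg R v = r) ∨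
      ∃ (S T : Finset V) (m : ℕ) (F : SimpleGraph V), Disjoint S T ∧
        (∀ A, ClosedIn F (S ∪ T)ᶜ A → (Γ.interedges A ((S ∪ T)ᶜ \ A)).card ≤ m) ∧
        ∀ Q ⊆ (S ∪ T)ᶜ, (∀ A, ClosedIn F (S ∪ T)ᶜ A → A.Nonempty → ∃ x ∈ A, x ∈ Q) →
          r * S.card + (Γ.interedges T Sᶜ).card + m + 2 ≤ r * T.card + Q.card := by
  have heven : Even (Fintype.card ((V × Fin r) ⊕ Γ.Dart)) := by
    rw [Fintype.card_sum, Fintype.card_prod, Fintype.card_fin, dart_card_eq_twice_card_edges]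
    exact (hr.mul_left _).add (even_two_mul _)
  rcases exists_isPerfectMatching_or_barrier (factorGadget Γ r) heven with ⟨M, hM⟩ | ⟨U, hU⟩
  · exact Or.inl (exists_factor_of_isPerfectMatching M hM)
  right
  obtain ⟨S, hS⟩ : ∃ S : Finset V, ∀ v, v ∈ S ↔ ∀ i, (.inl (v, i)) ∈ U :=
    ⟨Finset.univ.filter fun v => ∀ i, (.inl (v, i)) ∈ U, by simp⟩
  obtain ⟨T, hT⟩ : ∃ T : Finset V, ∀ v, v ∈ T ↔ v ∉ S ∧ ∀ d : Γ.Dart, d.fst = v → (.inr d) ∈ U :=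
    ⟨Finset.univ.filter fun v => v ∉ S ∧ ∀ d : Γ.Dart, d.fst = v → (.inr d) ∈ U, by simp⟩
  obtain ⟨D, hD⟩ : ∃ D : Finset (V × V), ∀ q, q ∈ D ↔ ∃ h : Γ.Adj q.1 q.2, (.inr ⟨q, h⟩) ∈ U :=
    ⟨Finset.univ.filter fun q => ∃ h : Γ.Adj q.1 q.2, (.inr ⟨q, h⟩) ∈ U, by simp⟩
  have hDd : ∀ d : Γ.Dart, d.toProd ∈ D ↔ .inr d ∈ U := fun d =>
    (hD _).trans ⟨fun h => h.2, fun h => ⟨d.adj, h⟩⟩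
  set C := (S ∪ T)ᶜ with hC
  have hCmem : ∀ v, v ∈ C ↔ v ∉ S ∧ v ∉ T := by intro v; simp [hC]
  have hCi : ∀ v ∈ C, ∃ i, (.inl (v, i)) ∉ U := by
    intro v hv
    have := ((hCmem v).1 hv).1
    rw [hS] at this
    push Not at this
    exact this
  have hCd : ∀ v ∈ C, ∃ d : Γ.Dart, d.fst = v ∧ (.inr d) ∉ U := by
    intro v hv
    have := ((hCmem v).1 hv).2
    rw [hT] at this
    push Not at this
    exact this ((hCmem v).1 hv).1
  choose rep hrep using hCi
  let MC := D.filter fun q => q.1 ∈ C ∧ q.2 ∈ C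
  let F : SimpleGraph V :=
    { Adj := fun v w => Γ.Adj v w ∧ (v, w) ∉ D ∧ (w, v) ∉ D
      symm := ⟨fun v w h => ⟨h.1.symm, h.2.2, h.2.1⟩⟩
      loopless := ⟨fun v h => Γ.loopless.irrefl v h.1⟩ }
  refine ⟨S, T, MC.card, F, ?_, ?_, ?_⟩
  · rw [Finset.disjoint_right]
    exact fun v hv => ((hT v).1 hv).1
  · intro A hA
    refine Finset.card_le_card_of_injOn (fun q => if q ∈ D then q else q.swap) ?_ ?_
    · rintro ⟨a, b⟩ hab
      simp only [Finset.mem_coe, Γ.mk_mem_interedges_iff, Finset.mem_sdiff] at hab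
      obtain ⟨ha, ⟨hb, hbA⟩, hadj⟩ := hab
      have haC := hA.1 ha
      by_cases h : (a, b) ∈ D
      · simpa [h, MC, hCmem] using And.intro haC hb
      · have : (b, a) ∈ D := by
          by_contra h'
          exact hbA (hA.2 a ha b hb ⟨hadj, h, h'⟩)
        simpa [h, MC, hCmem, this] using And.intro hb haC
    · rintro ⟨a, b⟩ hab ⟨a', b'⟩ hab' heq
      simp only [Finset.mem_coe, Γ.mk_mem_interedges_iff, Finset.mem_sdiff] at hab hab'
      simp only at heq
      split_ifs at heq <;> grind
  · intro Q hQC hQ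
    obtain ⟨P2, hP2⟩ : ∃ P2 : Finset Γ.Dart, ∀ d, d ∈ P2 ↔ d.fst ∈ S ∧ (.inr d.symm) ∈ U :=
      ⟨Finset.univ.filter fun d => d.fst ∈ S ∧ (.inr d.symm) ∈ U, by simp⟩
    let P1 : Finset (V × Fin r) :=
      (T ×ˢ Finset.univ) ∪ Q.attach.image fun q => (q.1, rep q.1 (hQC q.2))
    have hbound := hU (P1.disjSum P2) ?_
    · have hP1 : P1.card ≤ r * T.card + Q.card := by
        refine (Finset.card_union_le _ _).trans ?_
        rw [Finset.card_product, Finset.card_univ, Fintype.card_fin, mul_comm]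
        exact Nat.add_le_add_left (Finset.card_image_le.trans (by simp)) _
      have hUcard : r * S.card + D.card ≤ U.card := by
        let UD : Finset Γ.Dart := Finset.univ.filter fun d => .inr d ∈ U
        have hDc : D.card ≤ UD.card := by
          have : D ⊆ UD.image Dart.toProd := by
            intro q hq
            obtain ⟨h, hq⟩ := (hD q).1 hq
            exact Finset.mem_image.2 ⟨⟨q, h⟩, by simp [UD, hq], rfl⟩
          exact (Finset.card_le_card this).trans Finset.card_image_le
        have hsub : (S ×ˢ (Finset.univ : Finset (Fin r))).disjSum UD ⊆ U := by
          rintro (⟨v, i⟩ | d) hx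
          · simp only [Finset.inl_mem_disjSum, Finset.mem_product] at hx
            exact (hS v).1 hx.1 i
          · simpa [UD] using hx
        have := Finset.card_le_card hsub
        rw [Finset.card_disjSum, Finset.card_product, Finset.card_univ, Fintype.card_fin,
          mul_comm] at this
        omega
      have hD2 : P2.card + (Γ.interedges T Finset.univ).card + MC.card ≤
          D.card + (Γ.interedges T S).card := by
        let I := P2.image fun d => d.symm.toProd
        have hI : I.card = P2.card := Finset.card_image_of_injective _ fun d d' h =>
          Dart.symm_involutive.injective (Dart.toProd_injective h)
        have hImem : ∀ q ∈ I, q ∈ D ∧ q.2 ∈ S ∧ Γ.Adj q.1 q.2 := by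
          intro q hq
          obtain ⟨d, hd, rfl⟩ := Finset.mem_image.1 hq
          exact ⟨(hDd _).2 ((hP2 d).1 hd).2, ((hP2 d).1 hd).1, d.symm.adj⟩
        have hX : ∀ q ∈ Γ.interedges T Finset.univ, q ∈ D ∧ q.1 ∈ T := by
          intro q hq
          rw [Γ.mem_interedges_iff] at hq
          exact ⟨(hD q).2 ⟨hq.2.2, ((hT _).1 hq.1).2 _ rfl⟩, hq.1⟩
        have h1 := Finset.card_union_add_card_inter I (Γ.interedges T Finset.univ)
        have h2 : (I ∩ Γ.interedges T Finset.univ).card ≤ (Γ.interedges T S).card := by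
          refine Finset.card_le_card fun q hq => ?_
          rw [Finset.mem_inter] at hq
          have := hImem q hq.1
          exact Γ.mem_interedges_iff.2 ⟨(hX q hq.2).2, this.2.1, this.2.2⟩
        have h3 : Disjoint (I ∪ Γ.interedges T Finset.univ) MC := by
          rw [Finset.disjoint_left]
          intro q hq hM
          simp only [MC, Finset.mem_filter, hCmem] at hM
          rcases Finset.mem_union.1 hq with hq | hq
          · exact hM.2.2.1 (hImem q hq).2.1
          · exact hM.2.1.2 (hX q hq).2
        have h4 : (I ∪ Γ.interedges T Finset.univ) ∪ MC ⊆ D := by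
          intro q hq
          simp only [Finset.mem_union] at hq
          rcases hq with (hq | hq) | hq
          · exact (hImem q hq).1
          · exact (hX q hq).1
          · exact (Finset.mem_filter.1 hq).1
        have h5 := Finset.card_le_card h4
        rw [Finset.card_union_of_disjoint h3] at h5
        omega
      have hsplit : (Γ.interedges T Finset.univ).card =
          (Γ.interedges T S).card + (Γ.interedges T Sᶜ).card := by
        rw [← Finset.card_union_of_disjoint (Γ.interedges_disjoint_right T disjoint_compl_right)]
        congr 1
        ext q
        simp only [Γ.mem_interedges_iff, Finset.mem_union, Finset.mem_univ, Finset.mem_compl]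
        tauto
      rw [Finset.card_disjSum] at hbound
      omega
    · intro K hK hne hmin hodd
      by_contra! hPK
      have hKU : ∀ x ∈ K, x ∉ U := fun x hx => by simpa using hK.1 hx
      have hstep : ∀ x ∈ K, ∀ y, y ∉ U → (factorGadget Γ r).Adj x y → y ∈ K :=
        fun x hx y hy h => hK.2 x hx y (by simpa using hy) h
      have hcopy_dart : ∀ v i, .inl (v, i) ∈ K → ∀ d : Γ.Dart, d.fst = v → .inr d ∉ U →
          .inr d ∈ K := fun v i hv d hd hdU => hstep _ hv _ hdU (by simpa using hd)
      have hdart_copy : ∀ d : Γ.Dart, .inr d ∈ K → ∀ h : d.fst ∈ C,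
          .inl (d.fst, rep d.fst h) ∈ K := fun d hd h => hstep _ hd _ (hrep _ h) (by simp)
      have hAC : ∀ v ∈ C, ∀ i, .inl (v, i) ∉ K := by
        intro v hv i hvi
        let A := C.filter fun v => ∃ i, .inl (v, i) ∈ K
        have hA : ClosedIn F C A := by
          refine ⟨Finset.filter_subset _ _, ?_⟩
          intro a ha b hb hab
          obtain ⟨haC, j, haj⟩ := Finset.mem_filter.1 ha
          refine Finset.mem_filter.2 ⟨hb, rep b hb, ?_⟩
          have h1 := hcopy_dart a j haj ⟨(a, b), hab.1⟩ rfl (fun h => hab.2.1 ((hDd _).2 h))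
          have h2 := hstep _ h1 (.inr ⟨(b, a), hab.1.symm⟩)
            (fun h => hab.2.2 ((hDd _).2 h)) (by simp)
          exact hdart_copy _ h2 hb
        obtain ⟨q, hqA, hqQ⟩ := hQ A hA ⟨v, Finset.mem_filter.2 ⟨hv, i, hvi⟩⟩
        obtain ⟨hqC, j, hqj⟩ := Finset.mem_filter.1 hqA
        obtain ⟨d, hdq, hdU⟩ := hCd q hqC
        have h1 := hcopy_dart q j hqj d hdq hdU
        subst hdq
        refine hPK _ (hdart_copy d h1 hqC) ?_
        simp only [Finset.inl_mem_disjSum, P1, Finset.mem_union, Finset.mem_image]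
        exact Or.inr ⟨⟨_, hqQ⟩, by simp, rfl⟩
      obtain ⟨x, hx⟩ := hne
      rcases x with ⟨v, i⟩ | d
      · by_cases hvC : v ∈ C
        · exact hAC v hvC i hx
        · by_cases hvS : v ∈ S
          · exact hKU _ hx ((hS v).1 hvS i)
          · have hvT : v ∈ T := by
              by_contra h
              exact hvC ((hCmem v).2 ⟨hvS, h⟩)
            exact hPK _ hx (by simp [P1, hvT])
      · have hfst : ∀ d : Γ.Dart, .inr d ∈ K → d.fst ∈ S := by
          intro d hd
          by_contra hvS
          by_cases hvT : d.fst ∈ T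
          · exact hKU _ hd (((hT _).1 hvT).2 d rfl)
          · have hvC := (hCmem _).2 ⟨hvS, hvT⟩
            exact hAC _ hvC _ (hdart_copy d hd hvC)
        have hsU : .inr d.symm ∉ U := fun h => hPK _ hx (by simp [hP2, h, hfst d hx])
        have hsK : .inr d.symm ∈ K := hstep _ hx _ hsU (by simp)
        have hpair : ({.inr d, .inr d.symm} : Finset ((V × Fin r) ⊕ Γ.Dart)) = K := by
          refine hmin _ ?_ ⟨?_, ?_⟩ (by simp)
          · simp [Finset.insert_subset_iff, hx, hsK]
          · intro y hy
            simp only [Finset.mem_insert, Finset.mem_singleton] at hy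
            rcases hy with rfl | rfl
            · simpa using hKU _ hx
            · simpa using hsU
          · intro a ha b hb hab
            have hbU : b ∉ U := by simpa using hb
            simp only [Finset.mem_insert, Finset.mem_singleton] at ha ⊢
            have haK : a ∈ K := by rcases ha with rfl | rfl <;> assumption
            rcases b with ⟨w, j⟩ | d'
            · rcases ha with rfl | rfl
              · have hw : d.fst = w := by simpa using hab
                exact absurd ((hS _).1 (hw ▸ hfst d hx) j) hbU
              · have hw : d.symm.fst = w := by simpa using hab
                exact absurd ((hS _).1 (hw ▸ hfst _ hsK) j) hbU
            · rcases ha with rfl | rfl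
              · have : d' = d.symm := by simpa using hab
                exact Or.inr (by rw [this])
              · have : d' = d := by simpa using hab
                exact Or.inl (by rw [this])
        rw [← hpair, Finset.card_pair (by simpa using d.symm_ne.symm)] at hodd
        exact absurd hodd (by decide)

section Closed

variable {V : Type} [DecidableEq V] {F : SimpleGraph V} {C A B : Finset V}

lemma ClosedIn.union (hA : ClosedIn F C A) (hB : ClosedIn F C B) : ClosedIn F C (A ∪ B) := by
  refine ⟨Finset.union_subset hA.1 hB.1, fun a ha b hb hab => ?_⟩
  rcases Finset.mem_union.1 ha with ha | ha
  · exact Finset.mem_union_left _ (hA.2 a ha b hb hab)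
  · exact Finset.mem_union_right _ (hB.2 a ha b hb hab)

lemma ClosedIn.compl (hA : ClosedIn F C A) : ClosedIn F C (C \ A) := by
  refine ⟨Finset.sdiff_subset, fun a ha b hb hab => ?_⟩
  rw [Finset.mem_sdiff] at ha ⊢
  exact ⟨hb, fun hbA => ha.2 (hA.2 b hbA a ha.1 hab.symm)⟩

/-- If every closed set containing at most half of `C` is small, then a small set meets all
nonempty closed sets. -/
lemma exists_hitting_set {β : ℝ} (hβ : 0 ≤ β)
    (h : ∀ A, ClosedIn F C A → 2 * A.card ≤ C.card → (A.card : ℝ) ≤ β) :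
    ∃ Q ⊆ C, (∀ A, ClosedIn F C A → A.Nonempty → ∃ x ∈ A, x ∈ Q) ∧ (Q.card : ℝ) ≤ 1 + 3 * β := by
  have hne : (C.powerset.filter fun A => ClosedIn F C A ∧ 2 * A.card ≤ C.card).Nonempty :=
    ⟨∅, Finset.mem_filter.2 ⟨by simp, ⟨by simp, by simp⟩, by simp⟩⟩
  obtain ⟨A, hA, hmax⟩ := Finset.exists_max_image _ Finset.card hne
  obtain ⟨-, hAcl, hAhalf⟩ := Finset.mem_filter.1 hA
  have hmax' : ∀ B, ClosedIn F C B → 2 * B.card ≤ C.card → B.card ≤ A.card := fun B hB hB2 =>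
    hmax B (Finset.mem_filter.2 ⟨Finset.mem_powerset.2 hB.1, hB, hB2⟩)
  have hAβ := h A hAcl hAhalf
  by_cases hCA : C \ A = ∅
  · have hAC : A = C := Finset.Subset.antisymm hAcl.1 (Finset.sdiff_eq_empty_iff_subset.1 hCA)
    refine ⟨A, hAcl.1, fun B hB ⟨x, hx⟩ => ⟨x, hx, hAC ▸ hB.1 hx⟩, by linarith⟩
  obtain ⟨b, hb⟩ := Finset.nonempty_iff_ne_empty.2 hCA
  by_cases hhit : ∀ B, ClosedIn F C B → B.Nonempty → ∃ x ∈ B, x ∈ insert b A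
  · refine ⟨insert b A, Finset.insert_subset (Finset.mem_sdiff.1 hb).1 hAcl.1, hhit, ?_⟩
    have : ((insert b A).card : ℝ) ≤ A.card + 1 := by exact_mod_cast Finset.card_insert_le _ _
    linarith
  · push Not at hhit
    obtain ⟨X, hX, hXne, hXA⟩ := hhit
    have hXAdisj : Disjoint A X :=
      Finset.disjoint_right.2 fun x hx hxA => hXA x hx (Finset.mem_insert_of_mem hxA)
    have hbX : b ∉ X := fun hbX => hXA b hbX (Finset.mem_insert_self _ _)
    set Y := C \ (A ∪ X) with hYdef
    have hY : ClosedIn F C Y := (hAcl.union hX).compl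
    have hbY : b ∈ Y := by
      rw [Finset.mem_sdiff] at hb
      simp [hYdef, hb.1, hb.2, hbX]
    have hAYdisj : Disjoint A Y :=
      Finset.disjoint_right.2 fun x hx hxA =>
        (Finset.mem_sdiff.1 hx).2 (Finset.mem_union_left _ hxA)
    have hXpos : 0 < X.card := hXne.card_pos
    have hYpos : 0 < Y.card := Finset.card_pos.2 ⟨b, hbY⟩
    have hsum : A.card + X.card + Y.card = C.card := by
      rw [← Finset.card_union_of_disjoint hXAdisj, add_comm]
      exact Finset.card_sdiff_add_card_eq_card (hAcl.union hX).1
    have hbig : ∀ Z, ClosedIn F C Z → Disjoint A Z → 0 < Z.card →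
        C.card < 2 * (A.card + Z.card) := by
      intro Z hZ hdis hpos
      by_contra! hle
      have := hmax' _ (hAcl.union hZ) (by rwa [Finset.card_union_of_disjoint hdis])
      rw [Finset.card_union_of_disjoint hdis] at this
      omega
    have h1 := hbig X hX hXAdisj hXpos
    have h2 := hbig Y hY hAYdisj hYpos
    have hXβ := h X hX (by omega)
    have hYβ := h Y hY (by omega)
    refine ⟨C, Finset.Subset.rfl, fun B hB ⟨x, hx⟩ => ⟨x, hx, hB.1 hx⟩, ?_⟩
    have : (C.card : ℝ) = A.card + X.card + Y.card := by exact_mod_cast hsum.symm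
    linarith

end Closed

section EdgeCounts

variable {V : Type} (G : SimpleGraph V)

lemma card_interedges_eq_sum (A B : Finset V) :
    (G.interedges A B).card = ∑ v ∈ A, (B.filter (G.Adj v)).card := by
  rw [interedges_def, Finset.card_filter, Finset.sum_product]
  simp only [Finset.card_filter]

lemma deg_eq_card_filter [Fintype V] (v : V) :
    deg G v = (Finset.univ.filter (G.Adj v)).card := by
  rw [← Set.ncard_coe_finset]
  simp [deg, neighborSet]

lemma sum_deg_eq_card_interedges [Fintype V] (T : Finset V) :
    ∑ v ∈ T, deg G v = (G.interedges T Finset.univ).card := by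
  rw [card_interedges_eq_sum]
  exact Finset.sum_congr rfl fun v _ => deg_eq_card_filter G v

lemma card_interedges_union_left [DecidableEq V] {A B : Finset V} (h : Disjoint A B)
    (T : Finset V) :
    (G.interedges (A ∪ B) T).card = (G.interedges A T).card + (G.interedges B T).card := by
  simp only [card_interedges_eq_sum, Finset.sum_union h]

lemma card_interedges_symm (A B : Finset V) :
    (G.interedges A B).card = (G.interedges B A).card :=
  haveI := G.symm
  Rel.card_interedges_comm _ _

lemma card_interedges_union_right [DecidableEq V] {A B : Finset V} (h : Disjoint A B)
    (T : Finset V) :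
    (G.interedges T (A ∪ B)).card = (G.interedges T A).card + (G.interedges T B).card := by
  rw [card_interedges_symm, card_interedges_union_left G h, card_interedges_symm G A,
    card_interedges_symm G B]

lemma two_mul_eIn [Fintype V] (A : Finset V) :
    2 * eIn G (A : Set V) = (G.interedges A A).card := by
  let K : SimpleGraph V :=
    { Adj := fun v w => G.Adj v w ∧ v ∈ A ∧ w ∈ A
      symm := ⟨fun v w h => ⟨h.1.symm, h.2.2, h.2.1⟩⟩
      loopless := ⟨fun v h => G.loopless.irrefl v h.1⟩ }
  have h1 : eIn G (A : Set V) = K.edgeFinset.card := by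
    rw [eIn, ← Set.ncard_coe_finset, coe_edgeFinset]
    congr 1
    ext e
    induction e with
    | _ x y => simp [K]
  rw [h1, ← dart_card_eq_twice_card_edges, ← Finset.card_univ,
    ← Finset.card_image_of_injective _ Dart.toProd_injective]
  congr 1
  ext q
  simp only [Finset.mem_image, Finset.mem_univ, true_and, G.mem_interedges_iff]
  constructor
  · rintro ⟨d, rfl⟩
    have := d.adj
    exact ⟨this.2.1, this.2.2, this.1⟩
  · intro h
    exact ⟨⟨q, h.2.2, h.1, h.2.1⟩, rfl⟩

lemma eBtw_eq {A B : Finset V} (h : Disjoint A B) :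
    eBtw G (A : Set V) (B : Set V) = (G.interedges A B).card := by
  have himg : {e ∈ G.edgeSet | ∃ a ∈ (A : Set V), ∃ b ∈ (B : Set V), e = s(a, b)} =
      (fun q : V × V => s(q.1, q.2)) '' (G.interedges A B : Set (V × V)) := by
    ext e
    constructor
    · rintro ⟨he, a, ha, b, hb, rfl⟩
      exact ⟨(a, b), G.mk_mem_interedges_iff.2 ⟨ha, hb, he⟩, rfl⟩
    · rintro ⟨⟨a, b⟩, hab, rfl⟩
      have := G.mk_mem_interedges_iff.1 hab
      exact ⟨this.2.2, a, this.1, b, this.2.1, rfl⟩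
  rw [eBtw, himg, Set.InjOn.ncard_image, Set.ncard_coe_finset]
  rintro ⟨a, b⟩ hab ⟨a', b'⟩ hab' heq
  have h1 := G.mk_mem_interedges_iff.1 hab
  have h2 := G.mk_mem_interedges_iff.1 hab'
  rcases Sym2.eq_iff.1 heq with ⟨h3, h4⟩ | ⟨h3, h4⟩
  · exact Prod.ext h3 h4
  · simp only at h3 h4
    subst h3
    exact absurd h2.2.1 (Finset.disjoint_left.1 h h1.1)

end EdgeCounts

/-- The consequences of pseudorandomness used below, where `K` stands for `n * p`, `σ` for
`√(n * p * (1 - p))` and `L` for `log n`. -/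
structure Estimates {n : ℕ} (G : SimpleGraph (Fin n)) (p K σ L : ℝ) : Prop where
  p_pos : 0 < p
  p_le_one : p ≤ 1
  mul_eq : n * p = K
  le_L : 10 ≤ L
  L_le : 10 ^ 5 * L ≤ σ
  σ_le : 10 ^ 5 * σ ≤ K
  jumbled : ∀ A : Finset (Fin n),
    |((G.interedges A A).card : ℝ) - p * (A.card * (A.card - 1))| ≤ 4 * σ * A.card
  sparse : ∀ A B : Finset (Fin n), Disjoint A B →
    ((G.interedges A B).card : ℝ) ≤ 2 * (A.card + B.card) * L ∨
      ((G.interedges A B).card : ℝ) ≤ 7 * A.card * B.card * p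
  le_minDeg : 0.999 * K ≤ minDeg G
  minDeg_le : (minDeg G : ℝ) ≤ K - 200 * σ
  jumping : ∀ T : Finset (Fin n), T.Nonempty →
    T.card * (minDeg G : ℝ) + T.card * min ((T.card : ℝ) - 1) (L ^ 2) ≤ ∑ v ∈ T, (deg G v : ℝ)

lemma minDeg_le_deg {V : Type} (G : SimpleGraph V) (v : V) : minDeg G ≤ deg G v :=
  Nat.sInf_le ⟨v, rfl⟩

namespace Estimates

variable {n : ℕ} {G : SimpleGraph (Fin n)} {p K σ L : ℝ}

lemma interedges_bounds (E : Estimates G p K σ L) {A B : Finset (Fin n)} (h : Disjoint A B) :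
    |((G.interedges A B).card : ℝ) - p * A.card * B.card| ≤ 4 * σ * (A.card + B.card) := by
  have h1 := abs_le.1 (E.jumbled (A ∪ B))
  have h2 := abs_le.1 (E.jumbled A)
  have h3 := abs_le.1 (E.jumbled B)
  rw [card_interedges_union_left G h, card_interedges_union_right G h,
    card_interedges_union_right G h, card_interedges_symm G B A,
    Finset.card_union_of_disjoint h] at h1
  push_cast at h1
  rw [abs_le]
  constructor <;> linarith [h1.1, h1.2, h2.1, h2.2, h3.1, h3.2]

lemma le_card_interedges_union (E : Estimates G p K σ L) {T Z : Finset (Fin n)}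
    (h : Disjoint T Z) :
    p * T.card * (T.card + Z.card) - p * T.card - 4 * σ * (T.card + Z.card) ≤
      (G.interedges T (T ∪ Z)).card := by
  have h1 := abs_le.1 (E.jumbled (T ∪ Z))
  have h2 := abs_le.1 (E.jumbled T)
  have h3 := abs_le.1 (E.jumbled Z)
  rw [card_interedges_union_left G h, card_interedges_union_right G h,
    card_interedges_union_right G h, card_interedges_symm G Z T,
    Finset.card_union_of_disjoint h] at h1
  rw [card_interedges_union_right G h]
  push_cast at h1 ⊢
  linarith [h1.1, h1.2, h2.1, h2.2, h3.1, h3.2]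

lemma sum_deg_ge (A : Finset (Fin n)) :
    (minDeg G : ℝ) * A.card ≤ (G.interedges A Finset.univ).card := by
  rw [← sum_deg_eq_card_interedges, mul_comm]
  have := Finset.card_nsmul_le_sum A (fun v => deg G v) (minDeg G) fun v _ => minDeg_le_deg G v
  rw [smul_eq_mul] at this
  exact_mod_cast this

/-- After deletion of `W`, a small set meets all components of `G`, even if `m` further edges and
a matching are deleted. -/
lemma exists_small_hitting_set (E : Estimates G p K σ L) (W : Finset (Fin n))
    (F : SimpleGraph (Fin n)) (m : ℕ)
    (hF : ∀ A, ClosedIn F Wᶜ A → (G.interedges A (Wᶜ \ A)).card ≤ A.card + m) :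
    ∃ Q ⊆ Wᶜ, (∀ A, ClosedIn F Wᶜ A → A.Nonempty → ∃ x ∈ A, x ∈ Q) ∧
      (Q.card : ℝ) ≤ 1 + W.card / 100 + 3 * m / 10 := by
  obtain ⟨hp0, hp1, hKn, hL, hLσ, hσK, -, -, hδ, -, -⟩ := id E
  have hσ : 0 < σ := by linarith
  have hK : 0 < K := by linarith
  suffices hsmall : ∀ A, ClosedIn F Wᶜ A → 2 * A.card ≤ Wᶜ.card →
      (A.card : ℝ) ≤ W.card / 300 + m / 10 by
    obtain ⟨Q, hQC, hQ, hcard⟩ := exists_hitting_set (by positivity) hsmall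
    exact ⟨Q, hQC, hQ, by linarith⟩
  intro A hA hhalf
  have hAW : Disjoint A W := by
    rw [Finset.disjoint_left]
    exact fun x hx => Finset.mem_compl.1 (hA.1 hx)
  have hz : ((Wᶜ \ A).card : ℝ) = n - W.card - A.card := by
    have h1 := Finset.card_sdiff_add_card_eq_card hA.1
    have h2 := Finset.card_add_card_compl W
    rw [Fintype.card_fin] at h2
    have : ((Wᶜ \ A).card + A.card + W.card : ℝ) = n := by
      exact_mod_cast (by omega : (Wᶜ \ A).card + A.card + W.card = n)
    linarith
  have hhalf' : 2 * (A.card : ℝ) ≤ n - W.card := by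
    have h2 := Finset.card_add_card_compl W
    rw [Fintype.card_fin] at h2
    have h3 : (W.card + Wᶜ.card : ℝ) = n := by exact_mod_cast h2
    have : (2 * A.card : ℝ) ≤ Wᶜ.card := by exact_mod_cast hhalf
    linarith
  have hFA : ((G.interedges A (Wᶜ \ A)).card : ℝ) ≤ A.card + m := by exact_mod_cast hF A hA
  have hsplit : (G.interedges A Finset.univ).card =
      (G.interedges A A).card + (G.interedges A W).card + (G.interedges A (Wᶜ \ A)).card := by
    rw [← card_interedges_union_right G hAW, ← card_interedges_union_right]
    · congr 2
      ext x
      simp only [Finset.mem_univ, Finset.mem_union, Finset.mem_sdiff, Finset.mem_compl]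
      tauto
    · rw [Finset.disjoint_left]
      intro x hx
      simp only [Finset.mem_union, Finset.mem_sdiff, Finset.mem_compl] at hx ⊢
      tauto
  have hdeg := sum_deg_ge (G := G) A
  rw [hsplit] at hdeg
  push_cast at hdeg
  have h1 := (abs_le.1 (E.jumbled A)).2
  have h2 := (abs_le.1 (E.interedges_bounds hAW)).2
  have h3 := (abs_le.1 (E.interedges_bounds (A := A) (B := Wᶜ \ A) Finset.disjoint_sdiff)).1
  rw [hz] at h3
  have ha : (0 : ℝ) ≤ A.card := by positivity
  have hw : (0 : ℝ) ≤ W.card := by positivity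
  have hm : (0 : ℝ) ≤ m := by positivity
  set a : ℝ := (A.card : ℝ)
  set w : ℝ := (W.card : ℝ)
  by_cases hwn : w ≤ 0.8 * n
  · have h4 : p * a * (a + w) ≤ 0.9 * (K * a) := by
      rw [← hKn]
      have : (p * a) * (a + w) ≤ (p * a) * (0.9 * n) := by
        gcongr
        linarith
      linarith
    have h5 : 0.999 * K * a ≤ minDeg G * a := by gcongr
    have h6 : 10 ^ 5 * σ * a ≤ K * a := by gcongr
    have h7 : 10 ^ 5 * σ * w ≤ K * w := by gcongr
    have h8 : 10 ^ 5 * a ≤ K * a := by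
      gcongr
      linarith
    have h9 : 10 ^ 5 * m ≤ K * m := by
      gcongr
      linarith
    have hpa : 0 ≤ p * a := by positivity
    have : K * a ≤ K * (w / 300 + m / 10) := by
      have : 0 ≤ K * w := by positivity
      have : 0 ≤ K * m := by positivity
      linarith
    exact le_of_mul_le_mul_left this hK
  · push Not at hwn
    by_contra! hcon
    have hma : m ≤ 10 * a := by linarith
    have hzpos : 0 < n - w := by
      have : 0 < a := by
        have : 0 ≤ w / 300 + m / 10 := by positivity
        linarith
      linarith
    have h4 : p * a * (n - w) / 2 ≤ p * a * (n - w - a) := by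
      have : p * a * ((n - w) / 2) ≤ p * a * (n - w - a) := by
        gcongr
        linarith
      linarith
    have h5 : p * a ≤ 44 * σ := by
      by_cases hz' : 44 ≤ p * (n - w)
      · have h6 : 44 * a ≤ p * (n - w) * a := by gcongr
        have h7 : p * a * (n - w) ≤ 16 * σ * (n - w) := by linarith
        have := le_of_mul_le_mul_right h7 hzpos
        linarith
      · push Not at hz'
        have : p * a ≤ p * (n - w) := by
          gcongr
          linarith
        linarith
    have h6 : n * (p * a) ≤ n * (44 * σ) := by gcongr
    have h7 : 10 ^ 5 * σ * w ≤ K * w := by gcongr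
    have h8 : σ * (0.8 * n) ≤ σ * w := by gcongr
    have h9 : K * a ≤ K * (w / 300) := by
      have : K * a = n * (p * a) := by rw [← hKn]; ring
      have : 0 ≤ K * w := by positivity
      linarith
    have := le_of_mul_le_mul_left h9 hK
    have : (0 : ℝ) ≤ m / 10 := by positivity
    linarith

/-- The main term in Tutte's condition is nonnegative, up to the parity of odd components. -/
lemma tutte_main_term (E : Estimates G p K σ L) {Γ : SimpleGraph (Fin n)} {r : ℝ}
    (hdeg : ∀ v, ((deg G v : ℝ) - minDeg G) / 2 ≤ deg Γ v - r)
    (hup : ∀ S T : Finset (Fin n), Disjoint S T →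
      ((Γ.interedges T S).card : ℝ) ≤ (G.interedges T S).card + 4 * σ * S.card)
    (hlow : ∀ A B : Finset (Fin n),
      ((G.interedges A B).card : ℝ) ≤ (Γ.interedges A B).card + A.card)
    (hr : 0.998 * K ≤ r) (hr' : r ≤ K - 196 * σ) {S T : Finset (Fin n)} (hST : Disjoint S T) :
    (S.card + T.card - 1 : ℝ) ≤
      10 * (r * S.card + (Γ.interedges T Sᶜ).card - r * T.card) := by
  obtain ⟨hp0, hp1, hKn, hL, hLσ, hσK, -, -, -, -, -⟩ := id E
  have hσ : 0 < σ := by linarith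
  have hK : 0 < K := by linarith
  have hst : (S.card + T.card : ℝ) ≤ n := by
    have h1 : (S ∪ T).card ≤ n := by simpa using Finset.card_le_univ (S ∪ T)
    rw [Finset.card_union_of_disjoint hST] at h1
    exact_mod_cast h1
  have hs : (0 : ℝ) ≤ S.card := by positivity
  have ht : (0 : ℝ) ≤ T.card := by positivity
  by_cases htn : 10 * (T.card : ℝ) ≤ n
  · have hsum : (∑ v ∈ T, (deg Γ v : ℝ)) =
        (Γ.interedges T S).card + (Γ.interedges T Sᶜ).card := by
      have : (∑ v ∈ T, deg Γ v) = (Γ.interedges T S).card + (Γ.interedges T Sᶜ).card := by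
        rw [sum_deg_eq_card_interedges, ← card_interedges_union_right Γ disjoint_compl_right,
          Finset.union_compl]
      exact_mod_cast this
    have hexc : ((∑ v ∈ T, (deg G v : ℝ)) - T.card * minDeg G) / 2 ≤
        (∑ v ∈ T, (deg Γ v : ℝ)) - r * T.card := by
      have := Finset.sum_le_sum fun v (_ : v ∈ T) => hdeg v
      rw [← Finset.sum_div, Finset.sum_sub_distrib, Finset.sum_sub_distrib, Finset.sum_const,
        Finset.sum_const, nsmul_eq_mul, nsmul_eq_mul] at this
      linarith
    have hup' := hup S T hST
    have hrs : 0.998 * K * S.card ≤ r * S.card := by gcongr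
    have hσs : 10 ^ 5 * σ * S.card ≤ K * S.card := by gcongr
    have hLs : 10 ^ 5 * L * S.card ≤ σ * S.card := by gcongr
    have hLs' : 10 * (S.card : ℝ) ≤ L * S.card := by gcongr
    rcases T.eq_empty_or_nonempty with rfl | hT
    · simp only [Finset.card_empty, Γ.interedges_empty_left, G.interedges_empty_left,
        Finset.sum_empty] at *
      push_cast at *
      linarith
    have hjump := E.jumping T hT
    have ht1 : (1 : ℝ) ≤ T.card := by exact_mod_cast hT.card_pos
    by_cases htL : (T.card : ℝ) ≤ 8 * L
    · have hprod : ((G.interedges T S).card : ℝ) ≤ T.card * S.card := by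
        exact_mod_cast G.card_interedges_le_mul T S
      have h1 : (T.card : ℝ) * S.card ≤ 8 * L * S.card := by gcongr
      have h2 : (T.card : ℝ) - 1 ≤ T.card * min ((T.card : ℝ) - 1) (L ^ 2) := by
        rcases Nat.eq_or_lt_of_le (Nat.succ_le_of_lt hT.card_pos) with h | h
        · have hmin : (0 : ℝ) ≤ min ((T.card : ℝ) - 1) (L ^ 2) :=
            le_min (by linarith) (by positivity)
          have : (T.card : ℝ) = 1 := by exact_mod_cast h.symm
          rw [this] at hmin ⊢
          linarith
        · have hmin : (1 : ℝ) ≤ min ((T.card : ℝ) - 1) (L ^ 2) := by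
            refine le_min ?_ (by nlinarith)
            have : (2 : ℝ) ≤ T.card := by exact_mod_cast h
            linarith
          nlinarith
      linarith
    · push Not at htL
      have h2 : (T.card : ℝ) * (7 * L) ≤ T.card * min ((T.card : ℝ) - 1) (L ^ 2) := by
        gcongr
        exact le_min (by linarith) (by nlinarith)
      have hLt : 10 * (T.card : ℝ) ≤ L * T.card := by gcongr
      rcases E.sparse T S hST.symm with h | h
      · linarith
      · have h3 : 7 * (T.card : ℝ) * S.card * p ≤ 0.7 * (K * S.card) := by
          have : (p * S.card) * (10 * T.card) ≤ (p * S.card) * n := by gcongr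
          rw [← hKn]
          linarith
        linarith
  · push Not at htn
    have hZ : (Sᶜ : Finset (Fin n)) = T ∪ (S ∪ T)ᶜ := by
      ext x
      have : x ∈ S → x ∉ T := fun h => Finset.disjoint_left.1 hST h
      simp only [Finset.mem_compl, Finset.mem_union]
      tauto
    have hdis : Disjoint T (S ∪ T)ᶜ :=
      Finset.disjoint_left.2 fun x hx => by simp [hx]
    have hcard : (T.card : ℝ) + ((S ∪ T)ᶜ.card : ℝ) = n - S.card := by
      have h1 := Finset.card_add_card_compl (S ∪ T)
      rw [Finset.card_union_of_disjoint hST, Fintype.card_fin] at h1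
      have h2 : (S.card + T.card + (S ∪ T)ᶜ.card : ℝ) = n := by exact_mod_cast h1
      linarith
    have h1 := E.le_card_interedges_union hdis
    rw [hcard, ← hZ] at h1
    have h2 := hlow T Sᶜ
    have h3 : p * T.card ≤ σ * T.card := by
      gcongr
      linarith
    have h3' : 10 ^ 5 * (T.card : ℝ) ≤ σ * T.card := by
      gcongr
      linarith
    have h4 : σ * n ≤ σ * (10 * T.card) := by gcongr
    have hσs : 10 ^ 5 * σ * S.card ≤ K * S.card := by gcongr
    have hσs' : 0 ≤ σ * S.card := by positivity
    have hσs'' : 10 * (S.card : ℝ) ≤ σ * S.card := by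
      gcongr
      linarith
    have hnt : n * p * T.card = K * T.card := by rw [hKn]
    have hns : n * p * S.card = K * S.card := by rw [hKn]
    by_cases hcmp : (S.card : ℝ) ≤ T.card
    · have h5 : r * (T.card - S.card) ≤ (K - 196 * σ) * (T.card - S.card) := by
        gcongr
      by_cases hhalf : 2 * (S.card : ℝ) ≤ T.card
      · have h6 : 0 ≤ p * S.card * (n - T.card) := by
          have : (0 : ℝ) ≤ n - T.card := by linarith
          positivity
        have h7 : σ * (2 * S.card) ≤ σ * T.card := by gcongr
        linarith
      · push Not at hhalf
        have h6 : (p * S.card) * (n / 20) ≤ (p * S.card) * (n - T.card) := by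
          gcongr
          linarith
        linarith
    · push Not at hcmp
      have h5 : 0.998 * K * (S.card - T.card) ≤ r * (S.card - T.card) := by
        gcongr
      have h6 : (p * S.card) * T.card ≤ (p * S.card) * (n / 2) := by
        gcongr
        linarith
      have h7 : σ * T.card ≤ σ * S.card := by gcongr
      have h8 : K * T.card ≤ K * S.card := by gcongr
      linarith

end Estimates

lemma IsPseudorandom.estimates {n : ℕ} {G : SimpleGraph (Fin n)} {p : ℝ}
    (hG : IsPseudorandom n G p) (hp0 : 0 < p) (hp1 : p ≤ 1) (hL : 10 ≤ Real.log n)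
    (hσ : 10 ^ 6 * Real.log n ≤ √(n * p * (1 - p))) :
    Estimates G p (n * p) √(n * p * (1 - p)) (Real.log n) := by
  obtain ⟨hjum, hbtw, -, ⟨hδ, hδ', -⟩, hjump⟩ := hG
  have hn : (0 : ℝ) < n := by
    rcases Nat.eq_zero_or_pos n with rfl | h
    · norm_num at hL
    · exact_mod_cast h
  have hK : 0 < n * p := by positivity
  have hσK : 10 ^ 5 * √(n * p * (1 - p)) ≤ n * p := by
    have h1 : √(n * p * (1 - p)) * √(n * p * (1 - p)) ≤ n * p := by
      rw [Real.mul_self_sqrt (mul_nonneg hK.le (by linarith))]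
      have : 0 ≤ n * p * p := by positivity
      linarith
    have h2 : 10 ^ 5 * √(n * p * (1 - p)) ≤ √(n * p * (1 - p)) * √(n * p * (1 - p)) := by
      gcongr
      linarith
    linarith
  refine ⟨hp0, hp1, rfl, hL, by linarith, hσK, fun A => ?_, fun A B hAB => ?_, ?_, hδ',
    fun T hT => ?_⟩
  · have h := abs_le.1 (hjum A)
    have h2 : (2 * eIn G A : ℝ) = (G.interedges A A).card := by exact_mod_cast two_mul_eIn G A
    rw [Set.ncard_coe_finset] at h
    rw [← h2, abs_le]
    constructor <;> linarith [h.1, h.2]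
  · have h := hbtw A B (by exact_mod_cast hAB)
    rw [eBtw_eq G hAB, Set.ncard_coe_finset, Set.ncard_coe_finset] at h
    exact (le_total _ _).imp h.1 h.2
  · have : √(n * p * Real.log n) ≤ n * p / 2000 := by
      rw [Real.sqrt_le_iff]
      refine ⟨by positivity, ?_⟩
      have : n * p * Real.log n ≤ n * p * (n * p / 10 ^ 11) := by
        gcongr
        linarith
      have : 0 ≤ n * p * (n * p) := by positivity
      linarith
    linarith
  · have h := hjump T (by exact_mod_cast hT)
    have hpos : (0 : ℝ) < T.card := by exact_mod_cast hT.card_pos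
    have hTT : (Set.toFinite (T : Set (Fin n))).toFinset = T := T.finite_toSet_toFinset
    rw [Set.ncard_coe_finset, hTT, ge_iff_le, le_div_iff₀ hpos] at h
    linarith

lemma eventually_estimates {p : ℕ → ℝ} (hp : ∀ n, 0 ≤ p n ∧ p n ≤ 1)
    (h : Filter.Tendsto (fun n : ℕ => (n : ℝ) * p n * (1 - p n) / (Real.log n) ^ 2)
      Filter.atTop Filter.atTop) :
    ∀ᶠ n : ℕ in Filter.atTop, ∀ G : SimpleGraph (Fin n), IsPseudorandom n G (p n) →
      Estimates G (p n) (n * p n) √(n * p n * (1 - p n)) (Real.log n) := by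
  have hlog := (Real.tendsto_log_atTop.comp tendsto_natCast_atTop_atTop).eventually_ge_atTop 10
  filter_upwards [hlog, h.eventually_ge_atTop (10 ^ 12)] with n hL hn G hG
  simp only [Function.comp_apply] at hL
  rw [le_div_iff₀ (by positivity)] at hn
  refine hG.estimates ((hp n).1.lt_of_ne fun h0 => ?_) (hp n).2 hL (Real.le_sqrt_of_sq_le ?_)
  · rw [← h0] at hn
    nlinarith
  · linarith

namespace Estimates

variable {n : ℕ} {G : SimpleGraph (Fin n)} {p K σ L : ℝ}

lemma exists_matching_of_card_le_one (E : Estimates G p K σ L) {Y : Finset (Fin n)}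
    (hY : Y.card ≤ 1) (heven : Even (n - Y.card)) :
    ∃ M ≤ G, (∀ v ∈ Y, deg M v = 0) ∧ ∀ v ∉ Y, deg M v = 1 := by
  have hcard : Fintype.card {v // v ∉ Y} = n - Y.card := by
    rw [Fintype.card_subtype_compl, Fintype.card_fin, Fintype.card_coe]
  rcases exists_isPerfectMatching_or_barrier (G.comap ((↑) : {v // v ∉ Y} → Fin n))
    (hcard ▸ heven) with ⟨N, hN⟩ | ⟨U, hU⟩
  · refine ⟨⟨fun a b => ∃ (ha : a ∉ Y) (hb : b ∉ Y), N.Adj ⟨a, ha⟩ ⟨b, hb⟩,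
      ⟨fun a b ⟨ha, hb, h⟩ => ⟨hb, ha, h.symm⟩⟩, ⟨fun a ⟨_, _, h⟩ => N.loopless.irrefl _ h⟩⟩,
      fun a b ⟨ha, hb, h⟩ => N.adj_sub h, fun v hv => ?_, fun v hv => ?_⟩
    · rw [deg, Set.ncard_eq_zero]
      ext b
      simp [hv]
    · obtain ⟨w, hw, huniq⟩ := hN.1 (hN.2 ⟨v, hv⟩)
      rw [deg, Set.ncard_eq_one]
      refine ⟨w, Set.ext fun b => ⟨fun ⟨_, hb, h⟩ => ?_, ?_⟩⟩
      · exact congrArg Subtype.val (huniq ⟨b, hb⟩ h)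
      · rintro rfl
        exact ⟨hv, w.2, hw⟩
  · exfalso
    set ι : {v // v ∉ Y} ↪ Fin n := Function.Embedding.subtype _
    obtain ⟨Q, -, hQ, hcardQ⟩ := E.exists_small_hitting_set (U.map ι ∪ Y) G 0 fun A hA => by
      refine le_trans (le_of_eq (Finset.card_eq_zero.2 (Finset.eq_empty_of_forall_notMem ?_)))
        (Nat.zero_le _)
      rintro ⟨a, b⟩ hab
      rw [SimpleGraph.mem_interedges_iff] at hab
      obtain ⟨ha, hb, hadj⟩ := hab
      rw [Finset.mem_sdiff] at hb
      exact hb.2 (hA.2 a ha b hb.1 hadj)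
    have hcardU := hU (Q.subtype _) fun A hA ⟨a, ha⟩ _ _ => by
      have hcl : ClosedIn G (U.map ι ∪ Y)ᶜ (A.map ι) := by
        refine ⟨fun x hx => ?_, fun x hx y hy hxy => ?_⟩
        · obtain ⟨z, hz, rfl⟩ := Finset.mem_map.1 hx
          rw [Finset.mem_compl, Finset.mem_union, Finset.mem_map']
          exact fun h => h.elim (Finset.mem_compl.1 (hA.1 hz)) z.2
        · obtain ⟨z, hz, rfl⟩ := Finset.mem_map.1 hx
          rw [Finset.mem_compl, Finset.mem_union, not_or] at hy
          have hyU : (⟨y, hy.2⟩ : {v // v ∉ Y}) ∈ Uᶜ :=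
            Finset.mem_compl.2 fun h => hy.1 (Finset.mem_map_of_mem ι h)
          exact Finset.mem_map_of_mem ι (hA.2 z hz ⟨y, hy.2⟩ hyU hxy)
      obtain ⟨x, hx, hxQ⟩ := hQ (A.map ι) hcl ⟨ι a, Finset.mem_map_of_mem ι ha⟩
      obtain ⟨z, hz, rfl⟩ := Finset.mem_map.1 hx
      exact ⟨z, hz, Finset.mem_subtype.2 hxQ⟩
    have h1 : (Q.subtype fun v => v ∉ Y).card ≤ Q.card := by
      rw [Finset.card_subtype]
      exact Finset.card_filter_le _ _
    have h2 : (U.map ι ∪ Y).card ≤ U.card + 1 := by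
      have := Finset.card_union_le (U.map ι) Y
      rw [Finset.card_map] at this
      omega
    have h3 : (U.card + 2 : ℝ) ≤ Q.card := by exact_mod_cast hcardU.trans h1
    have h4 : ((U.map ι ∪ Y).card : ℝ) ≤ U.card + 1 := by exact_mod_cast h2
    have h5 : (0 : ℝ) ≤ U.card := by positivity
    push_cast at hcardQ
    linarith

/-- A pseudorandom graph has an optimal matching covering any given vertex. -/
lemma exists_optimal_matching (E : Estimates G p K σ L) (hn : 2 ≤ n) (x : Fin n) :
    ∃ M : SimpleGraph (Fin n), M ≤ G ∧ (∀ v, deg M v ≤ 1) ∧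
      M.edgeSet.ncard = n / 2 ∧ ∃ y, M.Adj x y := by
  obtain ⟨Y, hxY, hYcard⟩ : ∃ Y : Finset (Fin n), x ∉ Y ∧ Y.card = n % 2 := by
    have : Nontrivial (Fin n) := Fin.nontrivial_iff_two_le.2 hn
    obtain ⟨y, hy⟩ := exists_ne x
    rcases Nat.mod_two_eq_zero_or_one n with h | h
    · exact ⟨∅, by simp [h]⟩
    · exact ⟨{y}, by simp [h, hy.symm]⟩
  obtain ⟨M, hMG, hM0, hM1⟩ := E.exists_matching_of_card_le_one (Y := Y) (by omega)
    (by rw [Nat.even_iff]; omega)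
  refine ⟨M, hMG, fun v => ?_, ?_, ?_⟩
  · by_cases hv : v ∈ Y
    · simp [hM0 v hv]
    · simp [hM1 v hv]
  · have hsum : ∑ v, deg M v = 2 * M.edgeSet.ncard := by
      have := two_mul_eIn M Finset.univ
      rw [← sum_deg_eq_card_interedges] at this
      simpa [eIn] using this.symm
    have hsum' : ∑ v, deg M v = Yᶜ.card := by
      rw [← Finset.sum_add_sum_compl Y, Finset.sum_eq_zero hM0, zero_add,
        Finset.sum_congr rfl fun v hv => hM1 v (Finset.mem_compl.1 hv), Finset.card_eq_sum_ones]
    have := Finset.card_add_card_compl Y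
    rw [Fintype.card_fin] at this
    omega
  · have h1 := hM1 x hxY
    obtain ⟨y, hy⟩ := Set.ncard_eq_one.1 h1
    exact ⟨y, (Set.ext_iff.1 hy y).2 rfl⟩

end Estimates

section EdgeModification

variable {V : Type} [Finite V]

lemma deg_mono {G G' : SimpleGraph V} (h : G ≤ G') (v : V) : deg G v ≤ deg G' v :=
  Set.ncard_le_ncard fun _ hw => h hw

lemma deg_le_deg_sdiff_add_deg (G M : SimpleGraph V) (v : V) :
    deg G v ≤ deg (G \ M) v + deg M v := by
  refine (Set.ncard_le_ncard fun w hw => ?_).trans (Set.ncard_union_le _ _)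
  by_cases h : M.Adj v w
  · exact Or.inr h
  · exact Or.inl ⟨hw, h⟩

lemma deg_add_ncard_sdiff_le {G G' : SimpleGraph V} (h : G ≤ G') {x : V}
    (hx : ∀ e ∈ G'.edgeSet \ G.edgeSet, x ∈ e) :
    deg G x + (G'.edgeSet \ G.edgeSet).ncard ≤ deg G' x := by
  have hsub : G'.edgeSet \ G.edgeSet ⊆
      (fun w => s(x, w)) '' (G'.neighborSet x \ G.neighborSet x) := by
    rintro e he
    obtain ⟨w, rfl⟩ := Sym2.mem_iff_exists.1 (hx e he)
    exact ⟨w, ⟨he.1, he.2⟩, rfl⟩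
  have h1 := (Set.ncard_le_ncard hsub).trans (Set.ncard_image_le)
  have h2 : G.neighborSet x ⊆ G'.neighborSet x := fun _ hw => h hw
  have h3 := Set.ncard_sdiff_add_ncard_of_subset h2
  rw [deg, deg]
  omega

lemma eBtw_le_add_ncard_sdiff (G G' : SimpleGraph V) (S T : Set V) :
    eBtw G' S T ≤ eBtw G S T + (G'.edgeSet \ G.edgeSet).ncard := by
  refine (Set.ncard_le_ncard fun e he => ?_).trans (Set.ncard_union_le _ _)
  by_cases h : e ∈ G.edgeSet
  · exact Or.inl ⟨h, he.2⟩
  · exact Or.inr ⟨he.1, h⟩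

lemma eBtw_mono {G G' : SimpleGraph V} (h : G ≤ G') (S T : Set V) : eBtw G S T ≤ eBtw G' S T :=
  Set.ncard_le_ncard fun _ he => ⟨edgeSet_mono h he.1, he.2⟩

lemma card_interedges_le_sdiff_add_card {V : Type} [Fintype V] {G M Γ : SimpleGraph V}
    (hM : ∀ v, deg M v ≤ 1) (hΓ : G \ M ≤ Γ) (A B : Finset V) :
    (G.interedges A B).card ≤ (Γ.interedges A B).card + A.card := by
  rw [card_interedges_eq_sum, card_interedges_eq_sum, Finset.card_eq_sum_ones,
    ← Finset.sum_add_distrib]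
  refine Finset.sum_le_sum fun a _ => ?_
  have h1 : (Finset.univ.filter (M.Adj a)).card ≤ 1 := by
    rw [← deg_eq_card_filter]
    exact hM a
  refine le_trans (le_trans (Finset.card_le_card fun b hb => ?_) (Finset.card_union_le _ _))
    (Nat.add_le_add_left h1 _)
  rw [Finset.mem_filter] at hb
  by_cases h : M.Adj a b
  · exact Finset.mem_union_right _ (by simpa using h)
  · exact Finset.mem_union_left _ (Finset.mem_filter.2 ⟨hb.1, hΓ ⟨hb.2, h⟩⟩)

end EdgeModification

namespace Estimates

variable {n : ℕ} {G : SimpleGraph (Fin n)} {p K σ L : ℝ}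

lemma exists_factor (E : Estimates G p K σ L) {Γ : SimpleGraph (Fin n)} {r : ℕ} (hr : Even r)
    (hdeg : ∀ v, ((deg G v : ℝ) - minDeg G) / 2 ≤ deg Γ v - r)
    (hup : ∀ S T : Finset (Fin n), Disjoint S T →
      ((Γ.interedges T S).card : ℝ) ≤ (G.interedges T S).card + 4 * σ * S.card)
    (hlow : ∀ A B : Finset (Fin n),
      (G.interedges A B).card ≤ (Γ.interedges A B).card + A.card)
    (hr1 : 0.998 * K ≤ r) (hr2 : r ≤ K - 196 * σ) :
    ∃ R ≤ Γ, ∀ v, deg R v = r := by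
  refine (exists_factor_or_barrier Γ hr).resolve_right ?_
  rintro ⟨S, T, m, F, hST, hm, hbar⟩
  obtain ⟨Q, hQC, hQ, hcard⟩ := E.exists_small_hitting_set (S ∪ T) F m fun A hA => by
    have := hlow A ((S ∪ T)ᶜ \ A)
    have := hm A hA
    omega
  have h1 : (r * S.card + (Γ.interedges T Sᶜ).card + m + 2 : ℝ) ≤ r * T.card + Q.card := by
    exact_mod_cast hbar Q hQC hQ
  have h2 := E.tutte_main_term hdeg hup (fun A B => by exact_mod_cast hlow A B) hr1 hr2 hST
  rw [Finset.card_union_of_disjoint hST] at hcard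
  push_cast at hcard
  have : (0 : ℝ) ≤ m := by positivity
  have : (0 : ℝ) ≤ S.card := by positivity
  have : (0 : ℝ) ≤ T.card := by positivity
  linarith

/-- A jumping pseudorandom graph has a regular spanning subgraph after the addition of few edges at
the vertex of minimum degree. -/
lemma exists_regular_of_isJumping (E : Estimates G p K σ L) {u : ℕ} (hu : u ≤ 4 * σ)
    (hjump : IsJumping n G (2 * u)) {x₀ : Fin n} (hx₀ : deg G x₀ = minDeg G)
    {G' : SimpleGraph (Fin n)} (hGG' : G ≤ G') (hcard : (G'.edgeSet \ G.edgeSet).ncard = u)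
    (hinc : ∀ e ∈ G'.edgeSet \ G.edgeSet, x₀ ∈ e) {M : SimpleGraph (Fin n)}
    (hM : ∀ v, deg M v ≤ 1) :
    ∃ R ≤ (if Odd (minDeg G + u) then G' \ M else G'),
      ∀ v, deg R v = 2 * ((minDeg G + u) / 2) := by
  obtain ⟨-, -, -, hL, hLσ, hσK, -, -, hδ, hδ', -⟩ := id E
  have hdeg' : ∀ v, ((deg G v : ℝ) - minDeg G) / 2 ≤ deg G' v - minDeg G - u := by
    obtain ⟨x₁, hx₁, hjump⟩ := hjump
    intro v
    have hmono : (deg G v : ℝ) ≤ deg G' v := by exact_mod_cast deg_mono hGG' v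
    by_cases hv : v = x₁
    · subst hv
      rcases Nat.eq_zero_or_pos u with rfl | hupos
      · rw [hx₁] at hmono ⊢
        push_cast
        linarith
      · have : (0 : ℝ) < u := by exact_mod_cast hupos
        have hxv : x₀ = v := by
          by_contra hne
          have := hjump x₀ hne
          rw [hx₀] at this
          linarith
        subst hxv
        have : (deg G x₀ + u : ℝ) ≤ deg G' x₀ := by
          exact_mod_cast hcard ▸ deg_add_ncard_sdiff_le hGG' hinc
        rw [hx₀] at this ⊢
        linarith
    · have := hjump v hv
      linarith
  set Γ := if Odd (minDeg G + u) then G' \ M else G' with hΓ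
  have hΓG' : Γ ≤ G' := by
    rw [hΓ]
    split_ifs
    exacts [sdiff_le, le_rfl]
  have hGΓ : G \ M ≤ Γ := by
    rw [hΓ]
    split_ifs
    exacts [sdiff_le_sdiff_right hGG', sdiff_le.trans hGG']
  have hdegΓ : ∀ v, deg G' v + 2 * ((minDeg G + u) / 2) ≤ deg Γ v + (minDeg G + u) := by
    intro v
    rw [hΓ]
    split_ifs with hodd
    · have h1 := deg_le_deg_sdiff_add_deg G' M v
      have h2 := hM v
      rw [Nat.odd_iff] at hodd
      omega
    · omega
  refine E.exists_factor (even_two_mul _) (fun v => ?_) (fun S T hST => ?_)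
    (card_interedges_le_sdiff_add_card hM hGΓ) ?_ ?_
  · have h1 : (deg G' v + (2 * ((minDeg G + u) / 2) : ℕ) : ℝ) ≤ deg Γ v + (minDeg G + u) := by
      exact_mod_cast hdegΓ v
    linarith [hdeg' v]
  · rcases S.eq_empty_or_nonempty with rfl | hS
    · simp [SimpleGraph.interedges, Rel.interedges]
    · rw [← eBtw_eq _ hST.symm, ← eBtw_eq _ hST.symm]
      have h1 : (eBtw Γ T S : ℝ) ≤ eBtw G T S + u := by
        exact_mod_cast (eBtw_mono hΓG' _ _).trans (hcard ▸ eBtw_le_add_ncard_sdiff G G' _ _)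
      have h2 : (1 : ℝ) ≤ S.card := by exact_mod_cast hS.card_pos
      have h3 : 4 * σ * 1 ≤ 4 * σ * S.card := by
        gcongr
        linarith
      linarith
  · have : (minDeg G : ℝ) ≤ (2 * ((minDeg G + u) / 2) : ℕ) + 1 := by
      exact_mod_cast (by omega : minDeg G ≤ 2 * ((minDeg G + u) / 2) + 1)
    linarith
  · have : ((2 * ((minDeg G + u) / 2) : ℕ) : ℝ) ≤ minDeg G + u := by
      exact_mod_cast Nat.mul_div_le _ _
    linarith

end Estimates

end EDHC

open EDHC in
/-- Lemma 5.5 (Tutte). -/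
theorem stmt_11 (p : ℕ → ℝ) (hp : ∀ n, 0 ≤ p n ∧ p n ≤ 1)
    (h : Filter.Tendsto (fun n : ℕ => (n : ℝ) * p n * (1 - p n) / (Real.log n) ^ 2)
      Filter.atTop Filter.atTop) :
    ∃ N : ℕ, ∀ n : ℕ, N ≤ n → ∀ G : SimpleGraph (Fin n), IsPseudorandom n G (p n) →
      -- (i) optimal matchings covering any given vertex
      ((∀ x : Fin n, ∃ M : SimpleGraph (Fin n), M ≤ G ∧ (∀ v, deg M v ≤ 1) ∧
          M.edgeSet.ncard = n / 2 ∧ ∃ y, M.Adj x y) ∧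
      -- (ii) regular spanning subgraph after adding u edges at the minimum degree vertex
      (∀ u : ℕ, (u : ℝ) ≤ 4 * Real.sqrt ((n : ℝ) * p n * (1 - p n)) → u ≠ 1 →
        IsJumping n G (2 * u) →
        ∀ x₀ : Fin n, deg G x₀ = minDeg G →
        ∀ G' : SimpleGraph (Fin n), G ≤ G' →
          (G'.edgeSet \ G.edgeSet).ncard = u →
          (∀ e ∈ G'.edgeSet \ G.edgeSet, x₀ ∈ e) →
        ∀ M : SimpleGraph (Fin n), (∀ v, deg M v ≤ 1) →
          ∃ R : SimpleGraph (Fin n),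
            R ≤ (if Odd (minDeg G + u) then G' \ M else G') ∧
            ∀ v, deg R v = 2 * ((minDeg G + u) / 2))) := by
  obtain ⟨N, hN⟩ := Filter.eventually_atTop.1 (eventually_estimates hp h)
  refine ⟨max N 2, fun n hn G hG => ?_⟩
  have E := hN n (le_of_max_le_left hn) G hG
  refine ⟨E.exists_optimal_matching (le_of_max_le_right hn), ?_⟩
  intro u hu _ hjump x₀ hx₀ G' hGG' hcard hinc M hM
  exact E.exists_regular_of_isJumping hu hjump hx₀ hGG' hcard hinc hM
end

section
/- There exists N such that the following holds for all n ≥ N. Let B be an r_B-regular bipartite graph with vertex classes V = {v₁,…,vₙ} and V' = {v'₁,…,v'ₙ}. Let (log n)² ≤ r_G ≤ n and √(r_G)·log n ≤ r_B ≤ r_G/2, and let C = 2n√(r_G·log n)/r_B. Suppose that every S ⊆ V and T ⊆ V' with |S|, |T| ≥ n/√(r_G) satisfy e_B(S,T) ≤ 5r_G(|S|+|T|)²/(2n). Let X = (r_B/n)ⁿ·n!. Then the number of perfect matchings P of B such that the digraph D(P) has at least C cycles is strictly less than X. -/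
open scoped Classical
open SimpleGraph

namespace EDHC

open Finset Equiv

/-- A relation closed under one step of a permutation is closed under its cycles. -/
theorem sameCycle_imp_of_step {α : Type} (s : Setoid α) {e : Perm α}
    (h : ∀ x, s.r x (e x)) {x y : α} (hxy : e.SameCycle x y) : s.r x y := by
  obtain ⟨i, rfl⟩ := hxy
  induction i with
  | zero => exact s.refl x
  | succ i ih =>
    rw [add_comm, zpow_add, zpow_one, Perm.mul_apply]
    exact s.trans ih (h _)
  | pred i ih =>
    refine s.trans ih (s.symm ?_)
    have := h ((e ^ (-(i : ℤ) - 1)) x)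
    rwa [← Perm.mul_apply, ← zpow_one_add, add_sub_cancel] at this

/-- The setoid of lying on a common cycle. -/
abbrev cycleSetoid {α : Type} (σ : Perm α) : Setoid α :=
  ⟨σ.SameCycle, ⟨fun x => Perm.SameCycle.refl σ x, fun h => h.symm, fun h h' => h.trans h'⟩⟩

theorem cycleCount_le_of_surjective_mod {α β : Type} [Finite α] (e : Perm α) (σ : Perm β)
    (f : α → β) (hstep : ∀ x, σ.SameCycle (f x) (f (e x)))
    (hsurj : ∀ y, ∃ x, σ.SameCycle (f x) y) : cycleCount σ ≤ cycleCount e := by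
  refine Nat.card_le_card_of_surjective
    (Quotient.map' (s₁ := cycleSetoid e) (s₂ := cycleSetoid σ) f fun x y hxy =>
      sameCycle_imp_of_step ((cycleSetoid σ).comap f) hstep hxy) ?_
  intro q
  induction q using Quotient.inductionOn' with
  | h y =>
    obtain ⟨x, hx⟩ := hsurj y
    exact ⟨Quotient.mk'' x, Quotient.sound' hx⟩

theorem cycleCount_conj_le {α : Type} [Finite α] (τ σ : Perm α) :
    cycleCount (τ * σ * τ⁻¹) ≤ cycleCount σ := by
  refine cycleCount_le_of_surjective_mod _ _ τ (fun x => ⟨1, by simp⟩) 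
    fun y => ⟨τ.symm y, by simp [Perm.SameCycle.refl]⟩

theorem cycleCount_optionCongr_le {α : Type} [Finite α] (e : Perm α) :
    cycleCount (optionCongr e) ≤ cycleCount e + 1 := by
  have : cycleCount (optionCongr e) ≤ Nat.card (Option (Quotient (cycleSetoid e))) := by
    refine Nat.card_le_card_of_surjective
      (fun q : Option (Quotient (cycleSetoid e)) => q.elim
        (Quotient.mk (cycleSetoid (optionCongr e)) none)
        (Quotient.map' (s₁ := cycleSetoid e) (s₂ := cycleSetoid (optionCongr e)) some fun x y hxy =>
          sameCycle_imp_of_step ((cycleSetoid (optionCongr e)).comap some)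
            (fun x => ⟨1, by simp⟩) hxy)) ?_
    intro q
    induction q using Quotient.inductionOn' with
    | h y =>
      cases y with
      | none => exact ⟨none, rfl⟩
      | some y => exact ⟨some (Quotient.mk'' y), rfl⟩
  rwa [Finite.card_option] at this

theorem cycleCount_decomposeFin_symm_zero {n : ℕ} (e : Perm (Fin n)) :
    cycleCount (Perm.decomposeFin.symm (0, e)) ≤ cycleCount e + 1 := by
  refine le_trans (cycleCount_le_of_surjective_mod (optionCongr e) _
    (fun o : Option (Fin n) => o.elim 0 Fin.succ) ?_ ?_) (cycleCount_optionCongr_le e)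
  · rintro (_ | x)
    · exact Perm.SameCycle.refl _ _
    · exact ⟨1, by simp⟩
  · intro y
    refine Fin.cases ⟨none, Perm.SameCycle.refl _ _⟩
      (fun x => ⟨some x, Perm.SameCycle.refl _ _⟩) y

theorem cycleCount_decomposeFin_symm_succ {n : ℕ} {p : Fin (n + 1)} (hp : p ≠ 0)
    (e : Perm (Fin n)) :
    cycleCount (Perm.decomposeFin.symm (p, e)) ≤ cycleCount e := by
  refine cycleCount_le_of_surjective_mod e _ Fin.succ ?_ ?_
  · intro x
    by_cases h : (e x).succ = p
    · exact ⟨2, by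
        rw [zpow_two, Perm.mul_apply, Perm.decomposeFin_symm_apply_succ, h, swap_apply_right,
          Perm.decomposeFin_symm_apply_zero]⟩
    · refine ⟨1, ?_⟩
      rw [zpow_one, Perm.decomposeFin_symm_apply_succ,
        swap_apply_of_ne_of_ne (Fin.succ_ne_zero _) h]
  · refine Fin.cases ?_ fun x => ⟨x, Perm.SameCycle.refl _ _⟩
    obtain ⟨x, rfl⟩ := Fin.exists_succ_eq.2 hp
    exact ⟨x, Perm.SameCycle.symm ⟨1, by simp⟩⟩

/-- The number of columns still available to row `a`, when the values of `σ` are revealed in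
increasing order of rows. -/
noncomputable def available {n : ℕ} (R : Fin n → Fin n → Prop) (σ : Perm (Fin n))
    (a : Fin n) : ℕ := #{x | a ≤ x ∧ R a (σ x)}

/-- Cycles weighted by `2`, divided by the sequential choice counts, sum to at most `1`. -/
theorem sum_two_pow_cycleCount_div_available_le_one : ∀ (n : ℕ) (R : Fin n → Fin n → Prop),
    ∑ σ : Perm (Fin n), (if ∀ a, R a (σ a) then
      (2 : ℝ) ^ cycleCount σ * ∏ a, ((available R σ a : ℝ) + 1)⁻¹ else 0) ≤ 1 := by
  intro n
  induction n with
  | zero =>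
    intro R
    have h (σ : Perm (Fin 0)) : cycleCount σ = 0 := by
      unfold cycleCount
      exact Nat.card_eq_zero.2 (Or.inl ⟨fun q => by
        induction q using Quotient.inductionOn' with
        | h y => exact y.elim0⟩)
    simp [h]
  | succ n ih =>
    intro R
    set d : ℕ := #{x | R 0 x} with hd
    have hd0 : (0 : ℝ) < (d : ℝ) + 1 := by positivity
    have hterm : ∀ (p : Fin (n + 1)),
        ∑ e : Perm (Fin n), (if ∀ a, R a (Perm.decomposeFin.symm (p, e) a) then
          (2 : ℝ) ^ cycleCount (Perm.decomposeFin.symm (p, e)) *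
            ∏ a, ((available R (Perm.decomposeFin.symm (p, e)) a : ℝ) + 1)⁻¹ else 0)
        ≤ (if R 0 p then (1 + if p = 0 then (1 : ℝ) else 0) else 0) * ((d : ℝ) + 1)⁻¹ := by
      intro p
      by_cases hRp : R 0 p
      swap
      · rw [if_neg hRp, zero_mul]
        refine (Finset.sum_eq_zero fun e _ => if_neg fun h => hRp ?_).le
        simpa using h 0
      rw [if_pos hRp]
      set c : ℝ := (1 + if p = 0 then (1 : ℝ) else 0) with hc
      have hc0 : 0 ≤ c := by rw [hc]; positivity
      set R' : Fin n → Fin n → Prop := fun x y => R x.succ (swap 0 p y.succ) with hR'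
      calc _ ≤ ∑ e : Perm (Fin n), (c * ((d : ℝ) + 1)⁻¹) * (if ∀ a, R' a (e a) then
              (2 : ℝ) ^ cycleCount e * ∏ a, ((available R' e a : ℝ) + 1)⁻¹ else 0) := by
            refine Finset.sum_le_sum fun e _ => ?_
            by_cases hR : ∀ a, R a (Perm.decomposeFin.symm (p, e) a)
            swap
            · rw [if_neg hR]
              positivity
            have hR2 : ∀ a, R' a (e a) := fun a => by
              simpa [hR', Perm.decomposeFin_symm_apply_succ] using hR a.succ
            rw [if_pos hR, if_pos hR2, Fin.prod_univ_succ]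
            have h0 : available R (Perm.decomposeFin.symm (p, e)) 0 = d := by
              rw [hd, available]
              refine Finset.card_bij (fun x _ => Perm.decomposeFin.symm (p, e) x) ?_ ?_ ?_
              · intro x hx; simpa using hx
              · intro x _ y _ h; exact (Perm.decomposeFin.symm (p, e)).injective h
              · intro y hy
                exact ⟨(Perm.decomposeFin.symm (p, e)).symm y, by simpa using hy, by simp⟩
            have hs (a : Fin n) :
                available R (Perm.decomposeFin.symm (p, e)) a.succ = available R' e a := by
              rw [available, available]
              symm
              refine Finset.card_bij (fun x _ => x.succ) ?_ ?_ ?_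
              · intro x hx
                simpa [hR', Perm.decomposeFin_symm_apply_succ] using hx
              · intro x _ y _ h; exact Fin.succ_injective _ h
              · intro y hy
                simp only [mem_filter, mem_univ, true_and] at hy
                obtain ⟨x, rfl⟩ := Fin.exists_succ_eq.2
                  (ne_of_gt (lt_of_lt_of_le (Fin.succ_pos a) hy.1))
                exact ⟨x, by simpa [hR', Perm.decomposeFin_symm_apply_succ] using hy, rfl⟩
            have hcyc : (2 : ℝ) ^ cycleCount (Perm.decomposeFin.symm (p, e)) ≤
                c * 2 ^ cycleCount e := by
              by_cases hp : p = 0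
              · subst hp
                have := pow_le_pow_right₀ (one_le_two : (1 : ℝ) ≤ 2)
                  (cycleCount_decomposeFin_symm_zero e)
                rw [pow_succ] at this
                rw [hc, if_pos rfl]
                linarith
              · have := pow_le_pow_right₀ (one_le_two : (1 : ℝ) ≤ 2)
                  (cycleCount_decomposeFin_symm_succ hp e)
                rw [hc, if_neg hp]
                linarith
            simp only [h0, hs]
            calc _ ≤ (c * 2 ^ cycleCount e) *
                  (((d : ℝ) + 1)⁻¹ * ∏ a, ((available R' e a : ℝ) + 1)⁻¹) := by
                  gcongr
              _ = _ := by ring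
        _ ≤ c * ((d : ℝ) + 1)⁻¹ := by
            rw [← Finset.mul_sum]
            exact mul_le_of_le_one_right (by positivity) (ih R')
    rw [← Perm.decomposeFin.symm.sum_comp, Fintype.sum_prod_type]
    refine (Finset.sum_le_sum fun p _ => hterm p).trans ?_
    rw [← Finset.sum_mul, ← Finset.sum_filter, Finset.sum_add_distrib, mul_inv_le_iff₀ hd0]
    have h1 : ∑ p with R 0 p, (if p = 0 then (1 : ℝ) else 0) ≤ 1 := by
      rw [Finset.sum_ite_eq']
      split_ifs <;> norm_num
    have h2 : ∑ p with R 0 p, (1 : ℝ) = d := by simp [hd]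
    rw [h2]
    linarith

/-- The rows are revealed in the order prescribed by `τ`. -/
theorem sum_two_pow_cycleCount_div_available_of_order_le_one {n : ℕ} (R : Fin n → Fin n → Prop)
    (τ : Perm (Fin n)) :
    ∑ σ : Perm (Fin n), (if ∀ a, R a (σ a) then
      (2 : ℝ) ^ cycleCount σ * ∏ a, ((#{x | R a (σ x) ∧ τ a ≤ τ x} : ℝ) + 1)⁻¹ else 0) ≤ 1 := by
  refine le_trans ?_ (sum_two_pow_cycleCount_div_available_le_one n
    fun a b => R (τ⁻¹ a) (τ⁻¹ b))
  refine le_trans (Finset.sum_le_sum fun σ _ => ?_) ((MulAut.conj τ).toEquiv.sum_comp _).le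
  rw [show (MulAut.conj τ).toEquiv σ = τ * σ * τ⁻¹ from rfl]
  have hiff : (∀ a, R (τ⁻¹ a) (τ⁻¹ ((τ * σ * τ⁻¹) a))) ↔ ∀ a, R a (σ a) := by
    rw [← τ.forall_congr_right]
    simp
  by_cases h : ∀ a, R a (σ a)
  · rw [if_pos h, if_pos (hiff.2 h)]
    have hcyc : cycleCount σ ≤ cycleCount (τ * σ * τ⁻¹) := by
      have := cycleCount_conj_le τ⁻¹ (τ * σ * τ⁻¹)
      rwa [show τ⁻¹ * (τ * σ * τ⁻¹) * τ⁻¹⁻¹ = σ by group] at this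
    have hav (a : Fin n) : available (fun a b => R (τ⁻¹ a) (τ⁻¹ b)) (τ * σ * τ⁻¹) (τ a) =
        #{x | R a (σ x) ∧ τ a ≤ τ x} := by
      rw [available]
      symm
      refine Finset.card_bij (fun x _ => τ x) ?_ ?_ ?_
      · intro x hx
        simpa [and_comm] using hx
      · intro x _ y _ h; exact τ.injective h
      · intro y hy
        exact ⟨τ⁻¹ y, by simpa [and_comm] using hy, by simp⟩
    rw [← Equiv.prod_comp τ fun a => ((available (fun a b => R (τ⁻¹ a) (τ⁻¹ b))
      (τ * σ * τ⁻¹) a : ℝ) + 1)⁻¹]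
    simp only [hav]
    exact mul_le_mul_of_nonneg_right (pow_le_pow_right₀ one_le_two hcyc)
      (Finset.prod_nonneg fun a _ => inv_nonneg.2 (by positivity))
  · rw [if_neg h, if_neg (hiff.not.2 h)]

theorem sum_rank_eq {n : ℕ} (τ : Perm (Fin n)) (S : Finset (Fin n)) (f : ℕ → ℝ) :
    ∑ s ∈ S, f #{x ∈ S | τ s ≤ τ x} = ∑ k ∈ Icc 1 #S, f k := by
  have hlt : ∀ s ∈ S, ∀ t ∈ S, τ s < τ t → #{x ∈ S | τ t ≤ τ x} < #{x ∈ S | τ s ≤ τ x} := by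
    intro s hs t ht hst
    refine Finset.card_lt_card ⟨fun x hx => ?_, fun h => ?_⟩
    · simp only [mem_filter] at hx ⊢
      exact ⟨hx.1, hst.le.trans hx.2⟩
    · have := h (mem_filter.2 ⟨hs, le_rfl⟩)
      exact absurd hst (mem_filter.1 this).2.not_gt
  have hinj : Set.InjOn (fun s => #{x ∈ S | τ s ≤ τ x}) S := by
    intro s hs t ht h
    rcases lt_trichotomy (τ s) (τ t) with h1 | h1 | h1
    · exact absurd h (hlt s hs t ht h1).ne'
    · exact τ.injective h1
    · exact absurd h (hlt t ht s hs h1).ne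
  have himg : S.image (fun s => #{x ∈ S | τ s ≤ τ x}) = Icc 1 #S := by
    refine Finset.eq_of_subset_of_card_le ?_ ?_
    · intro k hk
      obtain ⟨s, hs, rfl⟩ := mem_image.1 hk
      exact mem_Icc.2 ⟨Finset.card_pos.2 ⟨s, mem_filter.2 ⟨hs, le_rfl⟩⟩,
        Finset.card_le_card (filter_subset _ _)⟩
    · rw [Finset.card_image_of_injOn hinj]
      simp
  rw [← himg, Finset.sum_image hinj]

/-- The rank of a fixed element of `S` under a random order is uniformly distributed. -/
theorem card_mul_sum_perm_rank {n : ℕ} (S : Finset (Fin n)) {a : Fin n} (ha : a ∈ S)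
    (f : ℕ → ℝ) :
    (#S : ℝ) * ∑ τ : Perm (Fin n), f #{x ∈ S | τ a ≤ τ x} =
      (n.factorial : ℝ) * ∑ k ∈ Icc 1 #S, f k := by
  have hsym : ∀ s ∈ S, ∑ τ : Perm (Fin n), f #{x ∈ S | τ s ≤ τ x} =
      ∑ τ : Perm (Fin n), f #{x ∈ S | τ a ≤ τ x} := by
    intro s hs
    rw [← Equiv.sum_comp (Equiv.mulRight (swap a s))]
    refine Finset.sum_congr rfl fun τ _ => ?_
    congr 1
    have hmem : ∀ x ∈ S, swap a s x ∈ S := by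
      intro x hx
      rw [swap_apply_def]
      split_ifs <;> assumption
    refine Finset.card_bij (fun x _ => swap a s x) ?_ ?_ ?_
    · intro x hx
      simp only [mem_filter, Equiv.coe_mulRight, Perm.mul_apply, swap_apply_right] at hx ⊢
      exact ⟨hmem x hx.1, hx.2⟩
    · intro x _ y _ h; exact (swap a s).injective h
    · intro y hy
      simp only [mem_filter] at hy
      exact ⟨swap a s y, by simpa using ⟨hmem y hy.1, hy.2⟩, by simp⟩
  calc (#S : ℝ) * ∑ τ : Perm (Fin n), f #{x ∈ S | τ a ≤ τ x}
      = ∑ s ∈ S, ∑ τ : Perm (Fin n), f #{x ∈ S | τ s ≤ τ x} := by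
        rw [Finset.sum_congr rfl hsym, Finset.sum_const, nsmul_eq_mul]
    _ = ∑ τ : Perm (Fin n), ∑ s ∈ S, f #{x ∈ S | τ s ≤ τ x} := Finset.sum_comm
    _ = _ := by
        simp only [sum_rank_eq, Finset.sum_const, nsmul_eq_mul, card_univ, Fintype.card_perm,
          Fintype.card_fin]

theorem card_mul_exp_mean_le_sum_exp {ι : Type} [Fintype ι] (y : ι → ℝ) (m : ℝ)
    (h : ∑ i, y i = Fintype.card ι * m) :
    Fintype.card ι * Real.exp m ≤ ∑ i, Real.exp (y i) := by
  calc Fintype.card ι * Real.exp m = ∑ i, Real.exp m * (y i - m + 1) := by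
        rw [← Finset.mul_sum, Finset.sum_add_distrib, Finset.sum_sub_distrib, h]
        simp [mul_comm]
    _ ≤ ∑ i, Real.exp (y i) := by
        refine Finset.sum_le_sum fun i _ => ?_
        calc Real.exp m * (y i - m + 1) ≤ Real.exp m * Real.exp (y i - m) := by
              gcongr
              exact Real.add_one_le_exp _
          _ = Real.exp (y i) := by rw [← Real.exp_add]; congr 1; ring

/-- A Brègman-type bound for the number of permutations in a row-regular relation, weighted by
`2` to the number of cycles. -/
theorem sum_two_pow_cycleCount_le {n r : ℕ} (hr : 0 < r) (R : Fin n → Fin n → Prop)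
    (hR : ∀ a, {b | R a b}.ncard = r) :
    ∑ σ : Perm (Fin n), (if ∀ a, R a (σ a) then (2 : ℝ) ^ cycleCount σ else 0) ≤
      Real.exp (n / r * ∑ k ∈ Icc 1 r, Real.log (k + 1)) := by
  set L : ℝ := ∑ k ∈ Icc 1 r, Real.log (k + 1) with hL
  have hr' : (0 : ℝ) < r := by exact_mod_cast hr
  have hmean : ∀ σ : Perm (Fin n), (∀ a, R a (σ a)) →
      (n.factorial : ℝ) * Real.exp (-(n / r * L)) ≤
        ∑ τ : Perm (Fin n), ∏ a, ((#{x | R a (σ x) ∧ τ a ≤ τ x} : ℝ) + 1)⁻¹ := by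
    intro σ hσ
    have hcard (a : Fin n) : #{x | R a (σ x)} = r := by
      rw [← hR a, Set.ncard_eq_toFinset_card']
      refine Finset.card_bij (fun x _ => σ x) ?_ ?_ ?_
      · intro x hx; simpa using hx
      · intro x _ y _ h; exact σ.injective h
      · intro y hy; exact ⟨σ⁻¹ y, by simpa using hy, by simp⟩
    have hrow (a : Fin n) : ∑ τ : Perm (Fin n),
        Real.log ((#{x | R a (σ x) ∧ τ a ≤ τ x} : ℝ) + 1) = (n.factorial : ℝ) * (L / r) := by
      have := card_mul_sum_perm_rank {x | R a (σ x)} (a := a) (by simpa using hσ a)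
        (fun k => Real.log ((k : ℝ) + 1))
      simp only [hcard, Finset.filter_filter, ← hL] at this
      field_simp
      linarith
    have key := card_mul_exp_mean_le_sum_exp
      (fun τ : Perm (Fin n) => ∑ a, -Real.log ((#{x | R a (σ x) ∧ τ a ≤ τ x} : ℝ) + 1))
      (-(n / r * L)) (by
        rw [Finset.sum_comm]
        simp only [Finset.sum_neg_distrib, hrow, Finset.sum_const, card_univ, Fintype.card_fin,
          Fintype.card_perm, nsmul_eq_mul]
        ring)
    rw [Fintype.card_perm, Fintype.card_fin] at key
    refine key.trans (le_of_eq (Finset.sum_congr rfl fun τ _ => ?_))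
    rw [Real.exp_sum]
    refine Finset.prod_congr rfl fun a _ => ?_
    rw [Real.exp_neg, Real.exp_log (by positivity)]
  have hsum : ∑ σ : Perm (Fin n), (if ∀ a, R a (σ a) then (2 : ℝ) ^ cycleCount σ else 0) *
      ((n.factorial : ℝ) * Real.exp (-(n / r * L))) ≤ n.factorial := by
    calc _ ≤ ∑ σ : Perm (Fin n), ∑ τ : Perm (Fin n), (if ∀ a, R a (σ a) then
          (2 : ℝ) ^ cycleCount σ * ∏ a, ((#{x | R a (σ x) ∧ τ a ≤ τ x} : ℝ) + 1)⁻¹ else 0) := by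
          refine Finset.sum_le_sum fun σ _ => ?_
          by_cases h : ∀ a, R a (σ a)
          · simp only [if_pos h, ← Finset.mul_sum]
            exact mul_le_mul_of_nonneg_left (hmean σ h) (by positivity)
          · simp [if_neg h]
      _ ≤ ∑ τ : Perm (Fin n), 1 := by
          rw [Finset.sum_comm]
          exact Finset.sum_le_sum fun τ _ =>
            sum_two_pow_cycleCount_div_available_of_order_le_one R τ
      _ = n.factorial := by simp [Fintype.card_perm]
  have hf : (0 : ℝ) < n.factorial := by positivity
  rw [← Finset.sum_mul, mul_left_comm, mul_le_iff_le_one_right hf, Real.exp_neg,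
    mul_inv_le_iff₀ (Real.exp_pos _), one_mul] at hsum
  exact hsum

theorem sum_log_succ_le (r : ℕ) :
    ∑ k ∈ Icc 1 r, Real.log (k + 1) ≤ (r + 2) * Real.log (r + 1) - r := by
  induction r with
  | zero => simp
  | succ r ih =>
    rw [Finset.sum_Icc_succ_top (by omega)]
    push_cast
    have h : Real.log (r + 1) ≤ Real.log (r + 1 + 1) - 1 / (r + 2) := by
      have := Real.log_le_sub_one_of_pos (show (0 : ℝ) < (r + 1) / (r + 1 + 1) by positivity)
      rw [Real.log_div (by positivity) (by positivity)] at this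
      have e : ((r : ℝ) + 1) / (r + 1 + 1) - 1 = - (1 / (r + 2)) := by field_simp; ring
      linarith
    have := mul_le_mul_of_nonneg_left h (show (0 : ℝ) ≤ r + 2 by positivity)
    rw [mul_sub, mul_one_div_cancel (by positivity)] at this
    linarith

theorem exp_mul_log_sub_le {n r : ℕ} (hn : 0 < n) (hr : 0 < r) :
    Real.exp (n * Real.log r - n) ≤ ((r : ℝ) / n) ^ n * n.factorial := by
  have h := Real.pow_div_factorial_le_exp (n : ℝ) (Nat.cast_nonneg n) n
  have hn' : (0 : ℝ) < n := by exact_mod_cast hn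
  have hr' : (0 : ℝ) < r := by exact_mod_cast hr
  rw [div_le_iff₀ (by positivity)] at h
  rw [Real.exp_sub, Real.exp_nat_mul, Real.exp_log hr', div_pow, div_mul_eq_mul_div,
    div_le_div_iff₀ (Real.exp_pos _) (by positivity), mul_assoc, mul_comm (n.factorial : ℝ)]
  gcongr

theorem one_add_two_mul_log_lt {n r : ℕ} {g : ℝ} (hr : 0 < r) (hl : 16 ≤ Real.log n)
    (hg : Real.log n ^ 2 ≤ g) (hrn : r + 1 ≤ n) :
    1 + 2 * Real.log (r + 1) < 2 * Real.sqrt (g * Real.log n) * Real.log 2 := by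
  have h1 : Real.log (r + 1) ≤ Real.log n := by
    refine Real.log_le_log (by positivity) ?_
    exact_mod_cast hrn
  have h2 : 4 * Real.log n ≤ Real.sqrt (g * Real.log n) := by
    refine Real.le_sqrt_of_sq_le ?_
    have := mul_le_mul_of_nonneg_right hg (show 0 ≤ Real.log n by linarith)
    nlinarith [sq_nonneg (Real.log n)]
  have h3 := Real.log_two_gt_d9
  nlinarith

end EDHC

open EDHC in
/-- Lemma 6.2 (SizeOfP): few perfect matchings with many cycles. -/
theorem stmt_12 :
    ∃ N : ℕ, ∀ n : ℕ, N ≤ n →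
      ∀ (R : Fin n → Fin n → Prop) (rB : ℕ) (rG : ℝ),
      (∀ a : Fin n, {b | R a b}.ncard = rB) →
      (∀ b : Fin n, {a | R a b}.ncard = rB) →
      (Real.log n) ^ 2 ≤ rG → rG ≤ n →
      Real.sqrt rG * Real.log n ≤ (rB : ℝ) → (rB : ℝ) ≤ rG / 2 →
      (∀ S T : Set (Fin n),
        (n : ℝ) / Real.sqrt rG ≤ (S.ncard : ℝ) → (n : ℝ) / Real.sqrt rG ≤ (T.ncard : ℝ) →
        (eBip R S T : ℝ) ≤ 5 * rG * ((S.ncard : ℝ) + (T.ncard : ℝ)) ^ 2 / (2 * n)) →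
      (Nat.card {σ : Equiv.Perm (Fin n) // (∀ a, R a (σ a)) ∧
          2 * (n : ℝ) * Real.sqrt (rG * Real.log n) / (rB : ℝ) ≤ (cycleCount σ : ℝ)} : ℝ)
        < ((rB : ℝ) / n) ^ n * (n.factorial : ℝ) := by
  refine ⟨⌈Real.exp 16⌉₊, fun n hn R r g hrow _ hg hgn hr1 hr2 _ => ?_⟩
  have hnexp : Real.exp 16 ≤ n := (Nat.le_ceil _).trans (by exact_mod_cast hn)
  have hn' : (0 : ℝ) < n := (Real.exp_pos _).trans_le hnexp
  have hl : 16 ≤ Real.log n := (Real.le_log_iff_exp_le hn').2 hnexp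
  have hg0 : 0 < g := lt_of_lt_of_le (by positivity) hg
  have hr' : (0 : ℝ) < r := lt_of_lt_of_le (by positivity) hr1
  have hr : 0 < r := by exact_mod_cast hr'
  have hrn : r + 1 ≤ n := by
    have : (r : ℝ) < n := by linarith
    exact_mod_cast this
  set C : ℝ := 2 * (n : ℝ) * Real.sqrt (g * Real.log n) / r with hC
  set L : ℝ := ∑ k ∈ Finset.Icc 1 r, Real.log (k + 1) with hL
  have hcount : (Nat.card {σ : Equiv.Perm (Fin n) // (∀ a, R a (σ a)) ∧
      C ≤ (cycleCount σ : ℝ)} : ℝ) * Real.exp (C * Real.log 2) ≤ Real.exp (n / r * L) := by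
    refine le_trans ?_ (sum_two_pow_cycleCount_le hr R hrow)
    rw [Nat.card_eq_fintype_card, Fintype.card_subtype, ← nsmul_eq_mul, ← Finset.sum_const,
      Finset.sum_filter]
    refine Finset.sum_le_sum fun σ _ => ?_
    by_cases h : ∀ a, R a (σ a)
    · rw [if_pos h]
      split_ifs with hc
      · calc Real.exp (C * Real.log 2) ≤ Real.exp (cycleCount σ * Real.log 2) := by
              gcongr
              exact hc.2
          _ = 2 ^ cycleCount σ := by rw [Real.exp_nat_mul, Real.exp_log two_pos]
      · positivity
    · rw [if_neg h, if_neg fun hc => h hc.1]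
  refine lt_of_lt_of_le ?_ (exp_mul_log_sub_le (by omega) hr)
  rw [← le_div_iff₀ (Real.exp_pos _), ← Real.exp_sub] at hcount
  refine hcount.trans_lt (Real.exp_lt_exp.2 ?_)
  have hL1 : L ≤ r * Real.log r - r + (1 + 2 * Real.log (r + 1)) := by
    have h1 := sum_log_succ_le r
    have h2 : Real.log (r + 1) ≤ Real.log r + 1 / r := by
      have := Real.log_le_sub_one_of_pos (show (0 : ℝ) < (r + 1) / r by positivity)
      rw [Real.log_div (by positivity) hr'.ne'] at this
      have e : ((r : ℝ) + 1) / r - 1 = 1 / r := by field_simp; ring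
      linarith
    have h3 := mul_le_mul_of_nonneg_left h2 hr'.le
    rw [mul_add, mul_one_div_cancel hr'.ne'] at h3
    linarith
  have hlt : L < r * Real.log r - r + 2 * Real.sqrt (g * Real.log n) * Real.log 2 :=
    hL1.trans_lt (by linarith [one_add_two_mul_log_lt hr hl hg hrn])
  have hmul := mul_lt_mul_of_pos_left hlt (show (0 : ℝ) < n / r by positivity)
  have e : (n : ℝ) / r * (r * Real.log r - r + 2 * Real.sqrt (g * Real.log n) * Real.log 2) =
      n * Real.log r - n + C * Real.log 2 := by
    rw [hC]
    field_simp
  linarith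
end

section
/- There exists N such that the following holds for all n ≥ N. Let r_G ≥ (log n)² and let G be an (r_G/n)-pseudorandom graph on n vertices. Let r_H ≥ 2√(r_G)·log n be even and let H be an r_H-regular spanning subgraph of G. Then H contains a 2-factor with at most 4n√(r_G·log n)/r_H cycles. -/
open scoped Classical
open SimpleGraph

namespace TwoFactor

section StablePolynomials

open MvPolynomial

variable {κ : Type}

/-- A homogeneous real polynomial of degree `m` all of whose degree `m` coefficients are positive
and which has no zeros in the open right half-plane (i.e. it is Hurwitz stable). -/
structure IsPosStable (p : MvPolynomial κ ℝ) (m : ℕ) : Prop where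
  isHomogeneous : p.IsHomogeneous m
  coeff_pos : ∀ α : κ →₀ ℕ, α.degree = m → 0 < coeff α p
  aeval_ne_zero : ∀ z : κ → ℂ, (∀ j, 0 < (z j).re) → aeval z p ≠ 0

lemma aeval_mul_of_isHomogeneous [Fintype κ] {p : MvPolynomial κ ℝ} {m : ℕ}
    (hp : p.IsHomogeneous m) (c : ℂ) (z : κ → ℂ) : aeval (fun j => c * z j) p = c ^ m * aeval z p := by
  rw [aeval_def, aeval_def, eval₂_eq', eval₂_eq', Finset.mul_sum]
  refine Finset.sum_congr rfl fun α hα => ?_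
  have : ∑ j, α j = m := by
    have := hp (mem_support_iff.mp hα)
    rw [Finsupp.weight_apply, Finsupp.sum_fintype _ _ (by simp)] at this
    simpa using this
  simp_rw [mul_pow, Finset.prod_mul_distrib, Finset.prod_pow_eq_pow_sum, this]
  ring

lemma aeval_ofReal [Fintype κ] (p : MvPolynomial κ ℝ) (x : κ → ℝ) :
    aeval (fun j => (x j : ℂ)) p = ((eval x p : ℝ) : ℂ) := by
  rw [aeval_def, eval₂_eq', eval_eq']
  push_cast
  rfl

namespace IsPosStable

variable {p : MvPolynomial κ ℝ} {m : ℕ}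

lemma coeff_nonneg (hp : IsPosStable p m) (α : κ →₀ ℕ) : 0 ≤ coeff α p := by
  by_cases h : α.degree = m
  · exact (hp.coeff_pos α h).le
  · exact (hp.isHomogeneous.coeff_eq_zero h).ge

lemma eval_pos [Fintype κ] (hp : IsPosStable p m) {x : κ → ℝ} (hx : ∀ j, 0 ≤ x j)
    {j : κ} (hj : 0 < x j) :
    0 < eval x p := by
  rw [eval_eq']
  have hc := hp.coeff_pos (Finsupp.single j m) (by simp)
  refine Finset.sum_pos' (fun α _ => mul_nonneg (hp.coeff_nonneg α)
    (Finset.prod_nonneg fun i _ => pow_nonneg (hx i) _))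
    ⟨Finsupp.single j m, mem_support_iff.mpr hc.ne', mul_pos hc (Finset.prod_pos fun i _ => ?_)⟩
  by_cases h : i = j
  · subst h; positivity
  · simp [Ne.symm h]

lemma mul_linear [Fintype κ] [Nonempty κ] (hp : IsPosStable p m) {a : κ → ℝ} (ha : ∀ j, 0 < a j) :
    IsPosStable ((∑ j, C (a j) * X j) * p) (m + 1) := by
  refine ⟨?_, fun α hα => ?_, fun z hz => ?_⟩
  · rw [add_comm]
    exact (IsHomogeneous.sum _ _ _ fun j _ => isHomogeneous_C_mul_X _ _).mul hp.isHomogeneous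
  · have hne : α ≠ 0 := by rintro rfl; simp at hα
    obtain ⟨j, hj⟩ := Finsupp.support_nonempty_iff.mpr hne
    simp_rw [Finset.sum_mul, coeff_sum, mul_assoc, coeff_C_mul, coeff_X_mul']
    refine Finset.sum_pos' (fun i _ => mul_nonneg (ha i).le ?_)
      ⟨j, Finset.mem_univ _, mul_pos (ha j) ?_⟩
    · split_ifs
      exacts [hp.coeff_nonneg _, le_rfl]
    · rw [if_pos hj]
      refine hp.coeff_pos _ ?_
      have hle : Finsupp.single j 1 ≤ α := by
        rw [Finsupp.single_le_iff]
        exact Nat.one_le_iff_ne_zero.mpr (Finsupp.mem_support_iff.mp hj)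
      have : (α - Finsupp.single j 1 + Finsupp.single j 1).degree = m + 1 := by
        rw [tsub_add_cancel_of_le hle, hα]
      rw [map_add] at this
      simpa using this
  · rw [map_mul]
    refine mul_ne_zero (fun h => ?_) (hp.aeval_ne_zero z hz)
    have h2 := congrArg Complex.re h
    simp only [map_sum, map_mul, aeval_X, algHom_C, Complex.re_sum, Complex.zero_re] at h2
    have : 0 < ∑ j, ((algebraMap ℝ ℂ) (a j) * z j).re := by
      refine Finset.sum_pos (fun j _ => ?_) Finset.univ_nonempty
      simpa using mul_pos (ha j) (hz j)
    exact this.ne' h2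

end IsPosStable

lemma isPosStable_one : IsPosStable (1 : MvPolynomial κ ℝ) 0 := by
  refine ⟨isHomogeneous_one _ _, fun α hα => ?_, fun z _ => by simp⟩
  rw [Finsupp.degree_eq_zero_iff] at hα
  simp [hα]

lemma isPosStable_prod_linear [Fintype κ] [Nonempty κ] {ι : Type} (s : Finset ι) {a : ι → κ → ℝ}
    (ha : ∀ i j, 0 < a i j) : IsPosStable (∏ i ∈ s, ∑ j, C (a i j) * X j) s.card := by
  induction s using Finset.induction_on with
  | empty => simpa using isPosStable_one
  | insert i s hi ih =>
    rw [Finset.prod_insert hi, Finset.card_insert_of_notMem hi]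
    exact ih.mul_linear (ha i)

/-- The restriction of `p` to the complex line through `z` in direction `j`. -/
noncomputable def lineRestrict (p : MvPolynomial κ ℝ) (z : κ → ℂ) (j : κ) : Polynomial ℂ :=
  aeval (fun i => if i = j then Polynomial.X else Polynomial.C (z i)) p

lemma eval_lineRestrict (p : MvPolynomial κ ℝ) (z : κ → ℂ) (j : κ) (t : ℂ) :
    (lineRestrict p z j).eval t = aeval (Function.update z j t) p := by
  induction p using MvPolynomial.induction_on with
  | C a => simp [lineRestrict, algHom_C,
      IsScalarTower.algebraMap_apply ℝ ℂ (Polynomial ℂ)]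
  | add p q hp hq => simp only [lineRestrict, map_add, Polynomial.eval_add] at *; rw [hp, hq]
  | mul_X p i hp =>
    simp only [lineRestrict, map_mul, Polynomial.eval_mul, aeval_X] at *
    rw [hp]
    by_cases h : i = j <;> simp [h]

lemma derivative_lineRestrict (p : MvPolynomial κ ℝ) (z : κ → ℂ) (j : κ) :
    (lineRestrict p z j).derivative = lineRestrict (pderiv j p) z j := by
  induction p using MvPolynomial.induction_on with
  | C a => simp [lineRestrict, algHom_C,
      IsScalarTower.algebraMap_apply ℝ ℂ (Polynomial ℂ)]
  | add p q hp hq => simp only [lineRestrict, map_add] at *; rw [hp, hq]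
  | mul_X p i hp =>
    simp only [lineRestrict, map_mul, aeval_X, Derivation.leibniz, smul_eq_mul, map_add,
      Polynomial.derivative_mul, pderiv_X] at *
    rw [hp]
    by_cases h : i = j
    · subst h; simp; ring
    · simp [h]; ring

namespace IsPosStable

variable {p : MvPolynomial κ ℝ} {m : ℕ}

lemma aeval_update_ne_zero [Fintype κ] (hp : IsPosStable p m) {x : κ → ℝ} (hx : ∀ i, 0 < x i)
    (j : κ) {t : ℂ} (ht : t ∈ Complex.slitPlane) :
    aeval (Function.update (fun i => (x i : ℂ)) j t) p ≠ 0 := by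
  have hw : 0 < (Complex.exp (Complex.log t / 2)).re := by
    rw [Complex.exp_re]
    refine mul_pos (Real.exp_pos _) (Real.cos_pos_of_mem_Ioo ?_)
    have h1 : (Complex.log t / 2).im = t.arg / 2 := by
      rw [← Complex.log_im]
      exact Complex.div_ofNat_im (Complex.log t) 2
    have h2 := Complex.neg_pi_lt_arg t
    have h3 := lt_of_le_of_ne (Complex.arg_le_pi t) (Complex.mem_slitPlane_iff_arg.mp ht).1
    rw [h1]
    constructor <;> linarith
  have hsq : Complex.exp (Complex.log t / 2) * Complex.exp (Complex.log t / 2) = t := by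
    rw [← Complex.exp_add, add_halves, Complex.exp_log (Complex.slitPlane_ne_zero ht)]
  set w := Complex.exp (Complex.log t / 2)
  intro h0
  refine hp.aeval_ne_zero (fun i => (starRingEnd ℂ) w *
    Function.update (fun i => (x i : ℂ)) j t i) (fun i => ?_) ?_
  · by_cases h : i = j
    · subst h
      have : (starRingEnd ℂ) w * t = (Complex.normSq w : ℂ) * w := by
        rw [← hsq, ← mul_assoc, mul_comm ((starRingEnd ℂ) w), Complex.mul_conj]
      rw [Function.update_self, this, Complex.re_ofReal_mul]
      refine mul_pos (Complex.normSq_pos.mpr ?_) hw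
      rintro h
      simp [h] at hw
    · rw [Function.update_of_ne h, Complex.re_mul_ofReal, Complex.conj_re]
      exact mul_pos hw (hx i)
  · rw [aeval_mul_of_isHomogeneous hp.isHomogeneous, h0, mul_zero]

lemma pderiv [Fintype κ] (hp : IsPosStable p (m + 1)) (j : κ) :
    IsPosStable (MvPolynomial.pderiv j p) m := by
  have hpos : ∀ α : κ →₀ ℕ, α.degree = m → 0 < coeff α (MvPolynomial.pderiv j p) := fun α hα => by
    rw [coeff_pderiv]
    exact mul_pos (hp.coeff_pos _ (by simp [hα])) (by positivity)
  refine ⟨by simpa using hp.isHomogeneous.pderiv (i := j), hpos, fun z hz h0 => ?_⟩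
  set F := lineRestrict p z j with hF
  have hroot : ∀ t : ℂ, F.eval t = 0 → t.re ≤ 0 := by
    intro t ht
    by_contra! hre
    rw [hF, eval_lineRestrict] at ht
    refine hp.aeval_ne_zero _ (fun i => ?_) ht
    by_cases h : i = j
    · subst h; simpa using hre
    · simpa [h] using hz i
  have hder : F.derivative.eval (z j) = 0 := by
    rw [hF, derivative_lineRestrict, eval_lineRestrict, Function.update_eq_self, h0]
  by_cases hF0 : F.derivative = 0
  · have hconst : ∀ t : ℂ, aeval (Function.update z j t) p = aeval z p := by
      intro t
      have h1 := Polynomial.eq_C_of_derivative_eq_zero hF0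
      have h2 : F.eval t = F.eval (z j) := by rw [h1]; simp
      rwa [hF, eval_lineRestrict, eval_lineRestrict, Function.update_eq_self] at h2
    have hlim : Filter.Tendsto
        (fun s : ℝ => aeval (Function.update (fun i => (s : ℂ) * z i) j 1) p)
        (nhdsWithin 0 (Set.Ioi 0))
        (nhds (aeval (Function.update (fun i => ((0 : ℝ) : ℂ) * z i) j 1) p)) := by
      refine Filter.Tendsto.mono_left (Continuous.tendsto ?_ 0) nhdsWithin_le_nhds
      simp_rw [aeval_def, eval₂_eq']
      refine continuous_finsetSum _ fun α _ => continuous_const.mul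
        (continuous_finsetProd _ fun i _ => Continuous.pow ?_ _)
      by_cases h : i = j
      · subst h; simp only [Function.update_self]; exact continuous_const
      · simp only [Function.update_of_ne h]; fun_prop
    have hlim' : Filter.Tendsto (fun s : ℝ => (s : ℂ) ^ (m + 1) * aeval z p)
        (nhdsWithin 0 (Set.Ioi 0)) (nhds (((0 : ℝ) : ℂ) ^ (m + 1) * aeval z p)) :=
      Filter.Tendsto.mono_left (Continuous.tendsto (by fun_prop) 0) nhdsWithin_le_nhds
    have heq : (fun s : ℝ => aeval (Function.update (fun i => (s : ℂ) * z i) j 1) p)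
        =ᶠ[nhdsWithin 0 (Set.Ioi 0)] fun s : ℝ => (s : ℂ) ^ (m + 1) * aeval z p := by
      filter_upwards [self_mem_nhdsWithin] with s hs
      have hs' : (s : ℂ) ≠ 0 := by exact_mod_cast (ne_of_gt hs)
      rw [← hconst (1 / (s : ℂ)), ← aeval_mul_of_isHomogeneous hp.isHomogeneous]
      congr 2
      funext i
      by_cases h : i = j
      · subst h; simp [hs']
      · simp [h]
    have h3 := tendsto_nhds_unique (hlim.congr' heq) hlim'
    have h4 : (Function.update (fun i => ((0 : ℝ) : ℂ) * z i) j 1) =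
        fun i => ((Pi.single j 1 : κ → ℝ) i : ℂ) := by
      funext i
      by_cases h : i = j
      · subst h; simp
      · simp [h]
    rw [h4, aeval_ofReal] at h3
    have h5 := hp.eval_pos (x := Pi.single j 1) (j := j) (fun i => by
      by_cases h : i = j
      · subst h; simp
      · simp [h]) (by simp)
    simp only [Complex.ofReal_zero, ne_eq, Nat.add_eq_zero_iff, one_ne_zero, and_false,
      not_false_eq_true, zero_pow, zero_mul, Complex.ofReal_eq_zero] at h3
    exact h5.ne' h3
  · have hdeg : 0 < F.degree := by
      by_contra! h
      exact hF0 (by rw [Polynomial.eq_C_of_degree_le_zero h]; simp)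
    have hmem : z j ∈ F.derivative.rootSet ℂ := by
      rw [Polynomial.mem_rootSet, Polynomial.coe_aeval_eq_eval]
      exact ⟨hF0, hder⟩
    have hsub : convexHull ℝ (F.rootSet ℂ) ⊆ {w : ℂ | w.re ≤ 0} := by
      refine convexHull_min (fun w hw => ?_) (convex_halfSpace_re_le 0)
      rw [Polynomial.mem_rootSet, Polynomial.coe_aeval_eq_eval] at hw
      exact hroot w hw.2
    exact absurd (hsub (Polynomial.rootSet_derivative_subset_convexHull_rootSet hdeg hmem))
      (not_le.mpr (hz j))

end IsPosStable

lemma norm_prod_sub_le_of_nonpos (M : Multiset ℂ) (hM : ∀ w ∈ M, w ∉ Complex.slitPlane) {s t : ℝ}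
    (hs : 0 < s) (hst : s ≤ t) :
    ‖(M.map fun w => (t : ℂ) - w).prod‖ ≤ ‖(M.map fun w => (s : ℂ) - w).prod‖ *
      Real.exp ((t - s) * (M.map fun w => 1 / ((s : ℂ) - w)).sum.re) := by
  induction M using Multiset.induction_on with
  | empty => simp
  | cons w M ih =>
    have ih := ih fun v hv => hM v (Multiset.mem_cons_of_mem hv)
    have hw := hM w (Multiset.mem_cons_self _ _)
    obtain ⟨a, ha, rfl⟩ : ∃ a : ℝ, 0 ≤ a ∧ w = ((-a : ℝ) : ℂ) := by
      rw [Complex.mem_slitPlane_iff, not_or, not_lt, not_not] at hw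
      exact ⟨-w.re, by linarith [hw.1], Complex.ext (by simp) (by simp [hw.2])⟩
    simp only [Multiset.map_cons, Multiset.prod_cons, Multiset.sum_cons, norm_mul, Complex.add_re,
      mul_add, Real.exp_add]
    have e : ∀ r : ℝ, (r : ℂ) - ((-a : ℝ) : ℂ) = ((r + a : ℝ) : ℂ) := fun r => by push_cast; ring
    have e1 : (1 / ((s : ℂ) - ((-a : ℝ) : ℂ))).re = 1 / (s + a) := by
      rw [e, ← Complex.ofReal_one, ← Complex.ofReal_div, Complex.ofReal_re]
    have key : ‖(t : ℂ) - ((-a : ℝ) : ℂ)‖ ≤ ‖(s : ℂ) - ((-a : ℝ) : ℂ)‖ *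
        Real.exp ((t - s) * (1 / ((s : ℂ) - ((-a : ℝ) : ℂ))).re) := by
      rw [e1, e, e, Complex.norm_of_nonneg (by linarith), Complex.norm_of_nonneg (by linarith)]
      calc t + a = (s + a) * ((t - s) * (1 / (s + a)) + 1) := by
            have : s + a ≠ 0 := by positivity
            field_simp; ring
        _ ≤ _ := by gcongr; exact Real.add_one_le_exp _
    calc _ ≤ _ := mul_le_mul key ih (norm_nonneg _) (by positivity)
      _ = _ := by ring

namespace IsPosStable

variable {p : MvPolynomial κ ℝ} {m : ℕ}

lemma exists_eval_update_le [Fintype κ] (hp : IsPosStable p (m + 1)) {x : κ → ℝ}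
    (hx : ∀ i, 0 < x i) (j : κ) :
    ∃ t > 0, eval (Function.update x j t) p ≤
      Real.exp 1 * t * eval x (MvPolynomial.pderiv j p) := by
  have hf := hp.eval_pos (fun i => (hx i).le) (hx j)
  have hf' := (hp.pderiv j).eval_pos (fun i => (hx i).le) (hx j)
  set f := eval x p
  set f' := eval x (MvPolynomial.pderiv j p)
  have hst : x j ≤ x j + f / f' := by linarith [div_pos hf hf']
  refine ⟨x j + f / f', by linarith [hx j], ?_⟩
  set F := lineRestrict p (fun i => (x i : ℂ)) j with hF
  have hval : ∀ (q : MvPolynomial κ ℝ) (t : ℝ),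
      (lineRestrict q (fun i => (x i : ℂ)) j).eval (t : ℂ) = ((eval (Function.update x j t) q : ℝ) : ℂ) := by
    intro q t
    rw [eval_lineRestrict, ← aeval_ofReal]
    congr 2
    funext i
    by_cases h : i = j
    · subst h; simp
    · simp [h]
  have hs : F.eval (x j : ℂ) = (f : ℂ) := by rw [hF, hval, Function.update_eq_self]
  have hd : F.derivative.eval (x j : ℂ) = (f' : ℂ) := by
    rw [hF, derivative_lineRestrict, hval, Function.update_eq_self]
  have hspl : F.Splits := IsAlgClosed.splits F
  have hr := norm_prod_sub_le_of_nonpos F.roots (fun w hw hw' => by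
    refine hp.aeval_update_ne_zero hx j hw' ?_
    rw [← eval_lineRestrict]
    exact (Polynomial.mem_roots'.mp hw).2) (hx j) hst
  rw [← hspl.eval_derivative_div_eval_of_ne_zero (by rw [hs]; exact_mod_cast hf.ne'), hs, hd,
    ← Complex.ofReal_div, Complex.ofReal_re, add_sub_cancel_left, div_mul_div_cancel₀ hf'.ne',
    div_self hf.ne'] at hr
  have h1 := mul_le_mul_of_nonneg_left hr (norm_nonneg F.leadingCoeff)
  rw [← mul_assoc, ← norm_mul, ← norm_mul, ← hspl.eval_eq_prod_roots, ← hspl.eval_eq_prod_roots,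
    hs, hF, hval] at h1
  rw [Complex.norm_real, Complex.norm_real, Real.norm_of_nonneg hf.le] at h1
  calc _ ≤ f * Real.exp 1 := (Real.le_norm_self _).trans h1
    _ = Real.exp 1 * (f / f') * f' := by field_simp
    _ ≤ _ := by gcongr; linarith [hx j]

/-- Gurvits' capacity inequality (weak form): the coefficient of a squarefree monomial. -/
lemma le_coeff_of_forall_le_eval [Fintype κ] (T : Finset κ) {c : ℝ} (hp : IsPosStable p T.card)
    (hc : ∀ x : κ → ℝ, (∀ j, 0 < x j) → c * ∏ j ∈ T, x j ≤ eval x p) :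
    c * Real.exp (-T.card) ≤ coeff (∑ j ∈ T, Finsupp.single j 1) p := by
  induction T using Finset.induction_on generalizing p c with
  | empty =>
    have h := hc (fun _ => 1) (fun _ => one_pos)
    have hC : p = C (coeff 0 p) := by
      have := hp.isHomogeneous
      rw [Finset.card_empty, ← totalDegree_zero_iff_isHomogeneous] at this
      exact totalDegree_eq_zero_iff_eq_C.mp this
    rw [hC] at h
    simpa using h
  | insert j T hj ih =>
    rw [Finset.card_insert_of_notMem hj] at hp ⊢
    have hq := hp.pderiv j
    have key := @ih (MvPolynomial.pderiv j p) (c * Real.exp (-1)) hq fun x hx => by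
      obtain ⟨t, ht, hle⟩ := hp.exists_eval_update_le hx j
      have h1 := hc (Function.update x j t) fun i => by
        by_cases h : i = j
        · subst h; simpa using ht
        · simpa [h] using hx i
      rw [Finset.prod_insert hj, Function.update_self] at h1
      have h2 : ∏ i ∈ T, Function.update x j t i = ∏ i ∈ T, x i :=
        Finset.prod_congr rfl fun i hi => Function.update_of_ne (by rintro rfl; exact hj hi) _ _
      rw [h2] at h1
      have h3 := h1.trans hle
      have h4 : t * (c * ∏ i ∈ T, x i) ≤ t * (Real.exp 1 * eval x (MvPolynomial.pderiv j p)) := by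
        linarith
      have h5 := le_of_mul_le_mul_left h4 ht
      calc c * Real.exp (-1) * ∏ i ∈ T, x i = Real.exp (-1) * (c * ∏ i ∈ T, x i) := by ring
        _ ≤ Real.exp (-1) * (Real.exp 1 * eval x (MvPolynomial.pderiv j p)) := by gcongr
        _ = _ := by rw [← mul_assoc, ← Real.exp_add]; simp
    rw [coeff_pderiv] at key
    have h0 : (∑ i ∈ T, Finsupp.single i 1 : κ →₀ ℕ) j = 0 := by
      rw [Finsupp.finsetSum_apply]
      exact Finset.sum_eq_zero fun i hi => Finsupp.single_eq_of_ne fun h => hj (h ▸ hi)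
    rw [h0, add_comm, ← Finset.sum_insert (f := fun i => Finsupp.single i 1) hj] at key
    refine le_trans (le_of_eq ?_) (key.trans (by simp))
    rw [mul_assoc, ← Real.exp_add]
    push_cast
    ring_nf

end IsPosStable

end StablePolynomials

section Permanent

open MvPolynomial

variable {V : Type} [Fintype V]

lemma coeff_prod_linear (a : V → V → ℝ) :
    coeff (∑ j, Finsupp.single j 1) (∏ i, ∑ j, C (a i j) * X j : MvPolynomial V ℝ) =
      ∑ σ : Equiv.Perm V, ∏ i, a i (σ i) := by
  have h1 : (∏ i, ∑ j, C (a i j) * X j : MvPolynomial V ℝ) =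
      ∑ g : V → V, monomial (∑ i, Finsupp.single (g i) 1) (∏ i, a i (g i)) := by
    rw [Finset.prod_univ_sum, Fintype.piFinset_univ]
    refine Finset.sum_congr rfl fun g _ => ?_
    rw [monomial_sum_prod]
    exact Finset.prod_congr rfl fun i _ => C_mul_X_eq_monomial
  rw [h1, coeff_sum]
  simp_rw [coeff_monomial]
  rw [← Finset.sum_image (s := Finset.univ) (f := fun g : V → V => ∏ i, a i (g i))
    (g := fun σ : Equiv.Perm V => (σ : V → V)) (fun σ _ τ _ h => DFunLike.coe_injective h)]
  have hval : ∀ (g : V → V) (w : V), (∑ i, Finsupp.single (g i) 1 : V →₀ ℕ) w =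
      ∑ i, if g i = w then 1 else 0 := fun g w => by
    rw [Finsupp.finsetSum_apply]
    exact Finset.sum_congr rfl fun i _ => Finsupp.single_apply
  symm
  rw [← Finset.sum_subset (Finset.subset_univ _)]
  · refine Finset.sum_congr rfl fun g hg => ?_
    obtain ⟨σ, -, rfl⟩ := Finset.mem_image.mp hg
    rw [if_pos]
    exact Equiv.sum_comp σ (fun j => Finsupp.single j 1)
  · intro g _ hg
    rw [if_neg]
    intro h
    refine hg (Finset.mem_image.mpr ?_)
    have hsurj : Function.Surjective g := fun w => by
      by_contra! hw
      have h2 := DFunLike.congr_fun h w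
      have h3 := hval id w
      simp only [id] at h3
      rw [hval, h3] at h2
      simp [hw] at h2
    exact ⟨Equiv.ofBijective g (Finite.surjective_iff_bijective.mp hsurj), Finset.mem_univ _, rfl⟩

/-- A weak form of the van der Waerden bound: a `d`-regular relation contains at least
`(d / e) ^ n` permutations. -/
lemma pow_le_card_perm (D : V → V → Prop) {d : ℕ} (hd : 0 < d)
    (hout : ∀ v, (Finset.univ.filter fun w => D v w).card = d)
    (hin : ∀ w, (Finset.univ.filter fun v => D v w).card = d) :
    ((d : ℝ) / Real.exp 1) ^ Fintype.card V ≤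
      ((Finset.univ.filter fun σ : Equiv.Perm V => ∀ v, D v (σ v)).card : ℝ) := by
  rcases isEmpty_or_nonempty V with hV | hV
  · simp
  have hdR : (0 : ℝ) < d := by exact_mod_cast hd
  have key : ∀ ε : ℝ, 0 < ε → ((d : ℝ) / Real.exp 1) ^ Fintype.card V ≤
      ∑ σ : Equiv.Perm V, ∏ v, ((if D v (σ v) then 1 else 0) + ε) := by
    intro ε hε
    have ha : ∀ v w, 0 < (if D v w then (1 : ℝ) else 0) + ε := fun v w => by
      split_ifs <;> linarith
    have h := (isPosStable_prod_linear Finset.univ ha).le_coeff_of_forall_le_eval Finset.univ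
      (c := (d : ℝ) ^ Fintype.card V) fun x hx => ?_
    · rw [coeff_prod_linear, Finset.card_univ] at h
      refine le_trans (le_of_eq ?_) h
      rw [div_pow, div_eq_mul_inv, Real.exp_neg, ← Real.exp_nat_mul, mul_one]
    · have hrow : ∀ v, (d : ℝ) * ∏ w ∈ Finset.univ.filter fun w => D v w, x w ^ ((d : ℝ)⁻¹) ≤
          ∑ w, ((if D v w then (1 : ℝ) else 0) + ε) * x w := by
        intro v
        have h1 := Real.geom_mean_le_arith_mean_weighted (Finset.univ.filter fun w => D v w)
          (fun _ => (d : ℝ)⁻¹) x (fun _ _ => by positivity)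
          (by rw [Finset.sum_const, hout, nsmul_eq_mul, mul_inv_cancel₀ hdR.ne'])
          (fun i _ => (hx i).le)
        calc _ ≤ (d : ℝ) * _ := mul_le_mul_of_nonneg_left h1 hdR.le
          _ = ∑ w ∈ Finset.univ.filter fun w => D v w, x w := by
            rw [← Finset.mul_sum, mul_inv_cancel_left₀ hdR.ne']
          _ = ∑ w, (if D v w then (1 : ℝ) else 0) * x w := by
            rw [Finset.sum_filter]
            exact Finset.sum_congr rfl fun w _ => by split_ifs <;> simp
          _ ≤ _ := Finset.sum_le_sum fun w _ =>
            mul_le_mul_of_nonneg_right (by linarith) (hx w).le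
      have hprod := Finset.prod_le_prod (s := Finset.univ)
        (fun v _ => mul_nonneg hdR.le (Finset.prod_nonneg fun w _ =>
          Real.rpow_nonneg (hx w).le _)) (fun v _ => hrow v)
      rw [Finset.prod_mul_distrib, Finset.prod_const, Finset.card_univ] at hprod
      rw [map_prod]
      simp only [map_sum, map_mul, eval_C, eval_X]
      refine le_trans (le_of_eq ?_) hprod
      congr 1
      simp_rw [Finset.prod_filter]
      rw [Finset.prod_comm]
      refine Finset.prod_congr rfl fun w _ => ?_
      rw [← Finset.prod_filter, Finset.prod_const, hin, ← Real.rpow_natCast,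
        ← Real.rpow_mul (hx w).le, inv_mul_cancel₀ hdR.ne', Real.rpow_one]
  have hlim : Filter.Tendsto
      (fun ε : ℝ => ∑ σ : Equiv.Perm V, ∏ v, ((if D v (σ v) then (1 : ℝ) else 0) + ε))
      (nhdsWithin 0 (Set.Ioi 0))
      (nhds (∑ σ : Equiv.Perm V, ∏ v, ((if D v (σ v) then (1 : ℝ) else 0) + 0))) :=
    Filter.Tendsto.mono_left (Continuous.tendsto (by fun_prop) 0) nhdsWithin_le_nhds
  refine (ge_of_tendsto hlim
    (by filter_upwards [self_mem_nhdsWithin] with ε hε using key ε hε)).trans (le_of_eq ?_)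
  rw [Finset.card_filter]
  push_cast
  refine Finset.sum_congr rfl fun σ _ => ?_
  simp_rw [add_zero]
  rw [Finset.prod_ite_zero]
  simp

end Permanent

section Bregman

variable {α β : Type} [Fintype β]

lemma card_mul_log_card_le {ι κ : Type} (S : Finset ι) (f : ι → κ) (B : Finset κ)
    (hf : ∀ e ∈ S, f e ∈ B) :
    (S.card : ℝ) * Real.log S.card ≤
      ∑ e ∈ S, (Real.log B.card + Real.log (S.filter fun e' => f e' = f e).card) := by
  rcases S.eq_empty_or_nonempty with rfl | hS
  · simp
  have hSc : (0 : ℝ) < S.card := by exact_mod_cast hS.card_pos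
  have hB : (0 : ℝ) < B.card := by
    obtain ⟨e, he⟩ := hS
    exact_mod_cast Finset.card_pos.mpr ⟨_, hf e he⟩
  have hpos : ∀ e ∈ S, (0 : ℝ) < (S.filter fun e' => f e' = f e).card := fun e he => by
    exact_mod_cast Finset.card_pos.mpr ⟨e, by simp [he]⟩
  have h1 : ∑ e ∈ S, (1 : ℝ) / (S.filter fun e' => f e' = f e).card ≤ B.card := by
    rw [Finset.sum_comp (fun b => (1 : ℝ) / (S.filter fun e' => f e' = b).card) f]
    calc _ = ∑ b ∈ S.image f, (1 : ℝ) := by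
          refine Finset.sum_congr rfl fun b hb => ?_
          obtain ⟨e, he, rfl⟩ := Finset.mem_image.mp hb
          rw [nsmul_eq_mul, mul_one_div_cancel (hpos e he).ne']
      _ = ((S.image f).card : ℝ) := by simp
      _ ≤ _ := by exact_mod_cast Finset.card_le_card (Finset.image_subset_iff.mpr hf)
  have h2 : ∀ e ∈ S, Real.log S.card - (Real.log B.card +
      Real.log (S.filter fun e' => f e' = f e).card) ≤
      (S.card : ℝ) / B.card * (1 / (S.filter fun e' => f e' = f e).card) - 1 := fun e he => by
    have h3 := Real.log_le_sub_one_of_pos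
      (x := (S.card : ℝ) / B.card * (1 / (S.filter fun e' => f e' = f e).card))
      (by have := hpos e he; positivity)
    rwa [Real.log_mul (by positivity) (by have := hpos e he; positivity),
      Real.log_div hSc.ne' hB.ne', one_div, Real.log_inv, ← sub_eq_add_neg, sub_sub,
      ← one_div] at h3
  have h4 := Finset.sum_le_sum h2
  rw [Finset.sum_sub_distrib, Finset.sum_sub_distrib, ← Finset.mul_sum] at h4
  simp only [Finset.sum_const, nsmul_eq_mul, mul_one] at h4
  have h5 : (S.card : ℝ) / B.card * ∑ e ∈ S, (1 : ℝ) / (S.filter fun e' => f e' = f e).card ≤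
      S.card := by
    calc _ ≤ (S.card : ℝ) / B.card * B.card := by gcongr
      _ = _ := by field_simp
  linarith

/-- The number of elements related to `a`. -/
noncomputable def outDegree (R : α → β → Prop) (a : α) : ℕ := (Finset.univ.filter (R a)).card

/-- Restriction of a relation to the transversals sending `a` to `b`. -/
def pin (R : α → β → Prop) (a : α) (b : β) (x : α) (y : β) : Prop :=
  if x = a then y = b else R x y ∧ y ≠ b

lemma outDegree_pin {R : α → β → Prop} {a x : α} {b : β} (hx : x ≠ a) :
    outDegree (pin R a b) x = if R x b then outDegree R x - 1 else outDegree R x := by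
  have : Finset.univ.filter (pin R a b x) = (Finset.univ.filter (R x)).erase b := by
    ext y; simp [pin, hx, and_comm]
  rw [outDegree, this, Finset.card_erase_eq_ite]
  simp [outDegree]

/-- The logarithm of the Bregman factor `(r!)^(1/r)`. -/
noncomputable def logRootFactorial (r : ℕ) : ℝ := Real.log r.factorial / r

lemma mul_logRootFactorial (r : ℕ) : r * logRootFactorial r = Real.log r.factorial := by
  rcases Nat.eq_zero_or_pos r with rfl | hr
  · simp
  · have : (r : ℝ) ≠ 0 := by positivity
    rw [logRootFactorial]
    field_simp

lemma logRootFactorial_mono : Monotone logRootFactorial := by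
  refine monotone_nat_of_le_succ fun r => ?_
  rcases Nat.eq_zero_or_pos r with rfl | hr
  · simp [logRootFactorial]
  have hr' : (0 : ℝ) < r := by exact_mod_cast hr
  rw [logRootFactorial, logRootFactorial, div_le_div_iff₀ hr' (by positivity), Nat.factorial_succ]
  push_cast
  rw [Real.log_mul (by positivity) (by positivity)]
  have : Real.log r.factorial ≤ r * Real.log (r + 1) := by
    rw [← Real.log_pow]
    refine Real.log_le_log (by positivity) ?_
    exact_mod_cast (Nat.factorial_le_pow r).trans (Nat.pow_le_pow_left (Nat.le_succ r) r)
  linarith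

variable [Fintype α]

/-- The bijections contained in a relation. -/
noncomputable def transversals (R : α → β → Prop) : Finset (α ≃ β) :=
  Finset.univ.filter fun e => ∀ a, R a (e a)

lemma mem_transversals {R : α → β → Prop} {e : α ≃ β} :
    e ∈ transversals R ↔ ∀ a, R a (e a) := by
  simp [transversals]

lemma transversals_pin {R : α → β → Prop} {a : α} {b : β} (h : R a b) :
    transversals (pin R a b) = (transversals R).filter fun e => e a = b := by
  ext e
  rw [Finset.mem_filter, mem_transversals, mem_transversals]
  constructor
  · intro he
    have hb : e a = b := by simpa [pin] using he a
    refine ⟨fun x => ?_, hb⟩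
    by_cases hx : x = a
    · subst hx; rwa [hb]
    · have := he x
      rw [pin, if_neg hx] at this
      exact this.1
  · rintro ⟨he, hb⟩ x
    by_cases hx : x = a
    · simp [pin, hx, hb]
    · rw [pin, if_neg hx]
      exact ⟨he x, fun h => hx (e.injective (h.trans hb.symm))⟩

lemma log_card_transversals_le_aux (k : ℕ) : ∀ (R : α → β → Prop) (A : Finset α), A.card = k →
    (∀ a ∉ A, ∃ b, R a b ∧ (∀ b', R a b' → b' = b) ∧ ∀ a' ≠ a, ¬ R a' b) →
    (transversals R).Nonempty →
    Real.log (transversals R).card ≤ ∑ a ∈ A, logRootFactorial (outDegree R a) := by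
  induction k with
  | zero =>
    intro R A hA hR hne
    obtain rfl := Finset.card_eq_zero.mp hA
    have : (transversals R).card ≤ 1 := by
      refine Finset.card_le_one.mpr fun e he e' he' => ?_
      ext a
      obtain ⟨b, -, hb, -⟩ := hR a (Finset.notMem_empty a)
      rw [hb _ (mem_transversals.mp he a), hb _ (mem_transversals.mp he' a)]
    have h1 : (transversals R).card = 1 := le_antisymm this hne.card_pos
    simp [h1]
  | succ k ih =>
    intro R A hA hR hne
    have hN : (0 : ℝ) < (transversals R).card := by exact_mod_cast hne.card_pos
    have step : ∀ e ∈ transversals R, ∀ a ∈ A,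
        Real.log ((transversals R).filter fun e' => e' a = e a).card ≤
          ∑ x ∈ A.erase a, logRootFactorial
            (if R x (e a) then outDegree R x - 1 else outDegree R x) := by
      intro e he a ha
      have hRe := mem_transversals.mp he
      rw [← transversals_pin (hRe a)]
      refine (ih (pin R a (e a)) (A.erase a) (by rw [Finset.card_erase_of_mem ha, hA]; rfl) ?_
        ⟨e, ?_⟩).trans (le_of_eq ?_)
      · intro x hx
        by_cases hxa : x = a
        · subst hxa
          exact ⟨e x, by simp [pin], by simp [pin], fun a' ha' => by simp [pin, ha']⟩
        · have hxA : x ∉ A := fun h => hx (Finset.mem_erase.mpr ⟨hxa, h⟩)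
          obtain ⟨b, hb, hb', hb''⟩ := hR x hxA
          have hne : b ≠ e a := fun h => hb'' a (Ne.symm hxa) (h ▸ hRe a)
          refine ⟨b, by simp [pin, hxa, hb, hne], fun b' h => ?_, fun a' ha' => ?_⟩
          · rw [pin, if_neg hxa] at h
            exact hb' b' h.1
          · by_cases h : a' = a
            · simp [pin, h, hne]
            · simp [pin, h, hb'' a' ha']
      · rw [transversals_pin (hRe a)]
        simp [he]
      · exact Finset.sum_congr rfl fun x hx => by rw [outDegree_pin (Finset.ne_of_mem_erase hx)]
    have total : ∀ e ∈ transversals R, ∑ a ∈ A, (Real.log (outDegree R a) +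
        Real.log ((transversals R).filter fun e' => e' a = e a).card) ≤
        (k + 1) * ∑ a ∈ A, logRootFactorial (outDegree R a) := by
      intro e he
      have hRe := mem_transversals.mp he
      refine (Finset.sum_le_sum fun a ha => add_le_add_right (step e he a ha) _).trans
        (le_of_eq ?_)
      rw [Finset.sum_add_distrib, Finset.sum_comm' (t' := A) (s' := fun x => A.erase x)
        (by intro x y; simp only [Finset.mem_erase]; tauto), ← Finset.sum_add_distrib,
        Finset.mul_sum]
      refine Finset.sum_congr rfl fun x hx => ?_
      have hrpos : 0 < outDegree R x :=
        Finset.card_pos.mpr ⟨e x, by simpa using hRe x⟩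
      obtain ⟨r, hr⟩ : ∃ r, outDegree R x = r + 1 := ⟨_, (Nat.succ_pred_eq_of_pos hrpos).symm⟩
      have hcard : ((A.erase x).filter fun a => R x (e a)).card = r := by
        have h1 : ((A.erase x).filter fun a => R x (e a)) =
            (Finset.univ.filter fun a => R x (e a)).erase x := by
          ext a
          simp only [Finset.mem_filter, Finset.mem_erase, Finset.mem_univ, true_and]
          constructor
          · rintro ⟨⟨h1, -⟩, h2⟩; exact ⟨h1, h2⟩
          · rintro ⟨h1, h2⟩
            refine ⟨⟨h1, ?_⟩, h2⟩
            by_contra haA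
            obtain ⟨b, -, hb, hb'⟩ := hR a haA
            exact hb' x (Ne.symm h1) (hb _ (hRe a) ▸ h2)
        have h2 : (Finset.univ.filter fun a => R x (e a)).card = outDegree R x := by
          rw [outDegree, ← Finset.card_map e.toEmbedding]
          congr 1
          ext b
          simp [Finset.mem_map_equiv]
        rw [h1, Finset.card_erase_of_mem (by simpa using hRe x), h2, hr]
        rfl
      have hcard' : ((A.erase x).filter fun a => ¬ R x (e a)).card + r = k := by
        have := Finset.card_filter_add_card_filter_not (s := A.erase x) (fun a => R x (e a))
        rw [hcard, Finset.card_erase_of_mem hx, hA] at this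
        omega
      have hcardR : (((A.erase x).filter fun a => ¬ R x (e a)).card : ℝ) = k - r := by
        rw [← hcard']; push_cast; ring
      simp_rw [apply_ite logRootFactorial]
      rw [Finset.sum_ite, Finset.sum_const, Finset.sum_const, hcard, nsmul_eq_mul, nsmul_eq_mul,
        hcardR, hr, Nat.add_sub_cancel, mul_logRootFactorial]
      have h3 := mul_logRootFactorial (r + 1)
      rw [Nat.factorial_succ, Nat.cast_mul, Real.log_mul (by positivity) (by positivity)] at h3
      push_cast at h3 ⊢
      linarith
    have main : ((k : ℝ) + 1) * ((transversals R).card * Real.log (transversals R).card) ≤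
        (transversals R).card * ((k + 1) * ∑ a ∈ A, logRootFactorial (outDegree R a)) := by
      calc _ = ∑ a ∈ A, ((transversals R).card * Real.log (transversals R).card : ℝ) := by
            rw [Finset.sum_const, hA, nsmul_eq_mul]; push_cast; ring
        _ ≤ ∑ a ∈ A, ∑ e ∈ transversals R, (Real.log (outDegree R a) +
            Real.log ((transversals R).filter fun e' => e' a = e a).card) :=
          Finset.sum_le_sum fun a _ => card_mul_log_card_le _ (fun e : α ≃ β => e a) _
            fun e he => by simpa using mem_transversals.mp he a
        _ = _ := Finset.sum_comm
        _ ≤ ∑ e ∈ transversals R, (k + 1) * ∑ a ∈ A, logRootFactorial (outDegree R a) :=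
          Finset.sum_le_sum total
        _ = _ := by rw [Finset.sum_const, nsmul_eq_mul]
    have hk : (0 : ℝ) < k + 1 := by positivity
    refine le_of_mul_le_mul_left ?_ (mul_pos hk hN)
    linarith

/-- **Bregman's theorem**, for relations of out-degree at most `d`. -/
lemma card_transversals_le (R : α → β → Prop) {d : ℕ} (hd : ∀ a, outDegree R a ≤ d) :
    ((transversals R).card : ℝ) ≤ Real.exp (Fintype.card α * logRootFactorial d) := by
  rcases (transversals R).eq_empty_or_nonempty with h | h
  · rw [h]; simp [Real.exp_nonneg]
  have hN : (0 : ℝ) < (transversals R).card := by exact_mod_cast h.card_pos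
  rw [← Real.log_le_iff_le_exp hN]
  refine (log_card_transversals_le_aux _ R Finset.univ rfl (by simp) h).trans ?_
  refine (Finset.sum_le_sum fun a _ => logRootFactorial_mono (hd a)).trans (le_of_eq ?_)
  simp

end Bregman

section CycleCounting

variable {V : Type} [Fintype V]

/-- A permutation is determined by the set of its values in `S` and its restriction away from
their preimages, provided that `S` meets each cycle at most once. -/
lemma perm_eq_of_eq_off {σ τ : Equiv.Perm V} {S : Finset V}
    (hσ : ∀ s ∈ S, ∀ t ∈ S, σ.SameCycle s t → s = t)
    (hτ : ∀ s ∈ S, ∀ t ∈ S, τ.SameCycle s t → s = t)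
    (hmem : ∀ x, σ x ∈ S ↔ τ x ∈ S) (heq : ∀ x, σ x ∉ S → σ x = τ x) : σ = τ := by
  ext u
  by_cases hu : σ u ∈ S
  swap
  · exact heq u hu
  have hex : ∃ j : ℕ, σ ((σ ^ j) (σ u)) ∈ S := by
    obtain ⟨j, hj⟩ := (Equiv.Perm.SameCycle.refl σ u).apply_left.exists_nat_pow_eq
    exact ⟨j, by rwa [hj]⟩
  have hagree : ∀ i ≤ Nat.find hex, (σ ^ i) (σ u) = (τ ^ i) (σ u) := by
    intro i
    induction i with
    | zero => simp
    | succ i ih =>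
      intro hi
      have h1 := Nat.find_min hex (Nat.lt_of_succ_le hi)
      rw [pow_succ', pow_succ', Equiv.Perm.mul_apply, Equiv.Perm.mul_apply, heq _ h1,
        ih (Nat.le_of_succ_le hi)]
  have hspec := Nat.find_spec hex
  set j := Nat.find hex
  have h1 : σ u = σ ((σ ^ j) (σ u)) := hσ _ hu _ hspec ⟨j + 1, by
    rw [← Nat.cast_succ, zpow_natCast, pow_succ', Equiv.Perm.mul_apply]⟩
  have h2 : (σ ^ j) (σ u) = u := (σ.injective h1).symm
  have h3 : τ u ∈ S := (hmem u).mp hu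
  refine hτ _ hu _ h3 ⟨j + 1, ?_⟩
  rw [← Nat.cast_succ, zpow_natCast, pow_succ', Equiv.Perm.mul_apply, ← hagree j le_rfl, h2]

lemma exists_finset_of_le_card_cycles {σ : Equiv.Perm V} {k : ℕ}
    (hk : k ≤ Nat.card (Quotient (Equiv.Perm.SameCycle.setoid σ))) :
    ∃ S : Finset V, S.card = k ∧ ∀ s ∈ S, ∀ t ∈ S, σ.SameCycle s t → s = t := by
  rw [Nat.card_eq_fintype_card, ← Finset.card_univ] at hk
  obtain ⟨Q, -, hQ⟩ := Finset.exists_subset_card_eq hk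
  refine ⟨Q.image Quotient.out, by
    rw [Finset.card_image_of_injective _ Quotient.out_injective, hQ], ?_⟩
  intro s hs t ht hst
  obtain ⟨q, -, rfl⟩ := Finset.mem_image.mp hs
  obtain ⟨q', -, rfl⟩ := Finset.mem_image.mp ht
  exact congrArg Quotient.out (Quotient.out_equiv_out.mp hst)

lemma card_transversals_le_of_cycles (D : V → V → Prop) {d k : ℕ}
    (hd : ∀ v, outDegree D v ≤ d)
    (hk : ∀ σ ∈ transversals D, k ≤ Nat.card (Quotient (Equiv.Perm.SameCycle.setoid σ))) :
    ((transversals D).card : ℝ) ≤ ((Fintype.card V).choose k : ℝ) ^ 2 *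
      Real.exp ((Fintype.card V - k : ℕ) * logRootFactorial d) := by
  set P := Finset.powersetCard k (Finset.univ : Finset V) with hP
  let T : Finset V × Finset V → Finset (Equiv.Perm V) := fun q => (transversals D).filter fun σ =>
    (∀ s ∈ q.2, ∀ t ∈ q.2, σ.SameCycle s t → s = t) ∧ ∀ x, x ∉ q.1 ↔ σ x ∉ q.2
  have hcover : transversals D ⊆ (P ×ˢ P).biUnion T := by
    intro σ hσ
    obtain ⟨S, hS, hS'⟩ := exists_finset_of_le_card_cycles (hk σ hσ)
    refine Finset.mem_biUnion.mpr ⟨(S.image σ.symm, S), ?_, ?_⟩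
    · simp [hP, Finset.mem_powersetCard, hS, Finset.card_image_of_injective _ σ.symm.injective]
    · refine Finset.mem_filter.mpr ⟨hσ, hS', fun x => not_congr ?_⟩
      simp [Equiv.symm_apply_eq]
  have hpiece : ∀ q ∈ P ×ˢ P, ((T q).card : ℝ) ≤
      Real.exp ((Fintype.card V - k : ℕ) * logRootFactorial d) := by
    rintro ⟨U, S⟩ hq
    have hU : U.card = k := by
      have := (Finset.mem_product.mp hq).1
      exact (Finset.mem_powersetCard.mp this).2
    let R : {x // x ∉ U} → {y // y ∉ S} → Prop := fun x y => D x y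
    have hR : ∀ x, outDegree R x ≤ d := fun x => by
      refine le_trans ?_ (hd x)
      rw [outDegree, outDegree, ← Finset.card_map (Function.Embedding.subtype _)]
      refine Finset.card_le_card fun y hy => ?_
      obtain ⟨z, hz, rfl⟩ := Finset.mem_map.mp hy
      simpa [R] using hz
    have hb := card_transversals_le R hR
    have hcard : Fintype.card {x // x ∉ U} = Fintype.card V - k := by
      rw [Fintype.card_subtype_compl, Fintype.card_coe, hU]
    rw [hcard] at hb
    refine le_trans ?_ hb
    have hinj : Fintype.card {σ // σ ∈ T (U, S)} ≤ Fintype.card {e // e ∈ transversals R} := by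
      refine Fintype.card_le_of_injective (fun σ => ⟨σ.1.subtypeEquiv
        (Finset.mem_filter.mp σ.2).2.2, mem_transversals.mpr fun x =>
          mem_transversals.mp (Finset.mem_filter.mp σ.2).1 x⟩) ?_
      rintro ⟨σ, hσ⟩ ⟨τ, hτ⟩ h
      obtain ⟨-, hσ1, hσ2⟩ := Finset.mem_filter.mp hσ
      obtain ⟨-, hτ1, hτ2⟩ := Finset.mem_filter.mp hτ
      refine Subtype.ext (perm_eq_of_eq_off hσ1 hτ1
        (fun x => not_iff_not.mp ((hσ2 x).symm.trans (hτ2 x))) fun x hx => ?_)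
      have h1 := congrArg (fun e => (e.1 ⟨x, (hσ2 x).mpr hx⟩).1) h
      simpa using h1
    rw [Fintype.card_coe, Fintype.card_coe] at hinj
    exact_mod_cast hinj
  calc ((transversals D).card : ℝ) ≤ (((P ×ˢ P).biUnion T).card : ℝ) := by
        exact_mod_cast Finset.card_le_card hcover
    _ ≤ ∑ q ∈ P ×ˢ P, ((T q).card : ℝ) := by exact_mod_cast Finset.card_biUnion_le
    _ ≤ ∑ q ∈ P ×ˢ P, Real.exp ((Fintype.card V - k : ℕ) * logRootFactorial d) :=
      Finset.sum_le_sum hpiece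
    _ = _ := by
      rw [Finset.sum_const, Finset.card_product, hP, Finset.card_powersetCard, Finset.card_univ,
        nsmul_eq_mul]
      push_cast
      ring

end CycleCounting

section Orientation

variable {V : Type} [Fintype V]

/-- Each edge of a `2 * d`-regular graph can be assigned to one of its endpoints so that every vertex
receives exactly `d` edges. -/
lemma exists_balanced_assignment (H : SimpleGraph V) {d : ℕ} (hH : ∀ v, H.degree v = 2 * d) :
    ∃ f : H.edgeSet → V, (∀ e, f e ∈ e.1) ∧
      ∀ v, (Finset.univ.filter fun e => f e = v).card = d := by
  let t : H.edgeSet → Finset (V × Fin d) := fun e => Finset.univ.filter fun q => q.1 ∈ e.1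
  have hall : ∀ F : Finset H.edgeSet, F.card ≤ (F.biUnion t).card := by
    intro F
    let T : Finset V := Finset.univ.filter fun v => ∃ e ∈ F, v ∈ e.1
    have hT : F.biUnion t = T ×ˢ Finset.univ := by
      ext ⟨v, i⟩
      simp [t, T]
    have h2 : ∀ e ∈ F, (T.filter fun v => v ∈ e.1).card = 2 := by
      rintro ⟨e, he⟩ heF
      induction e using Sym2.ind with
      | _ a b =>
        have hab : a ≠ b := H.ne_of_adj he
        have : (T.filter fun v => v ∈ s(a, b)) = {a, b} := by
          ext v
          simp only [T, Finset.mem_filter, Finset.mem_univ, true_and, Sym2.mem_iff,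
            Finset.mem_insert, Finset.mem_singleton, and_iff_right_iff_imp]
          rintro h
          exact ⟨_, heF, by simpa using h⟩
        rw [this, Finset.card_pair hab]
    have h3 : ∀ v ∈ T, (F.filter fun e => v ∈ e.1).card ≤ 2 * d := by
      intro v _
      rw [← hH v, ← H.card_incidenceFinset_eq_degree v,
        ← Finset.card_map (Function.Embedding.subtype _)]
      refine Finset.card_le_card fun e he => ?_
      obtain ⟨e', he', rfl⟩ := Finset.mem_map.mp he
      rw [SimpleGraph.mem_incidenceFinset]
      exact ⟨e'.2, (Finset.mem_filter.mp he').2⟩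
    have h4 := Finset.sum_card_bipartiteAbove_eq_sum_card_bipartiteBelow (s := F) (t := T)
      (fun e v => v ∈ e.1)
    simp only [Finset.bipartiteAbove, Finset.bipartiteBelow] at h4
    rw [Finset.sum_congr rfl h2, Finset.sum_const, smul_eq_mul] at h4
    have h5 := Finset.sum_le_sum h3
    rw [Finset.sum_const, smul_eq_mul] at h5
    rw [hT, Finset.card_product, Finset.card_univ, Fintype.card_fin]
    nlinarith
  obtain ⟨f, hf, hft⟩ := (Finset.all_card_le_biUnion_card_iff_exists_injective t).mp hall
  have hcard : Fintype.card H.edgeSet = Fintype.card (V × Fin d) := by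
    have h := H.sum_degrees_eq_twice_card_edges
    simp only [hH, Finset.sum_const, Finset.card_univ, smul_eq_mul,
      SimpleGraph.edgeFinset_card] at h
    rw [Fintype.card_prod, Fintype.card_fin]
    have h' : 2 * Fintype.card H.edgeSet = 2 * (Fintype.card V * d) := by rw [← h]; ring
    exact Nat.eq_of_mul_eq_mul_left two_pos h'
  have hbij : Function.Bijective f := (Fintype.bijective_iff_injective_and_card f).mpr ⟨hf, hcard⟩
  refine ⟨fun e => (f e).1, fun e => by simpa [t] using hft e, fun v => ?_⟩
  rw [← Finset.card_map ⟨f, hf⟩]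
  have : (Finset.univ.filter fun e => (f e).1 = v).map ⟨f, hf⟩ = {v} ×ˢ Finset.univ := by
    ext ⟨w, i⟩
    simp only [Finset.mem_map, Finset.mem_filter, Finset.mem_univ, true_and,
      Function.Embedding.coeFn_mk, Finset.mem_product, Finset.mem_singleton, and_true]
    constructor
    · rintro ⟨e, he, h⟩; rw [← he, h]
    · rintro rfl
      obtain ⟨e, he⟩ := hbij.2 (w, i)
      exact ⟨e, by rw [he], he⟩
  rw [this]
  simp

/-- A `2 * d`-regular graph has an orientation with all in-degrees and out-degrees equal to `d`. -/
lemma exists_balanced_orientation (H : SimpleGraph V) {d : ℕ} (hH : ∀ v, H.degree v = 2 * d) :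
    ∃ D : V → V → Prop, (∀ u v, D u v → H.Adj u v) ∧ (∀ u v, D u v → ¬ D v u) ∧
      (∀ v, (Finset.univ.filter fun w => D v w).card = d) ∧
      ∀ w, (Finset.univ.filter fun v => D v w).card = d := by
  obtain ⟨f, hf, hfd⟩ := exists_balanced_assignment H hH
  obtain ⟨D, hD⟩ : ∃ D : V → V → Prop, ∀ u v, D u v ↔ ∃ h : H.Adj u v, f ⟨s(u, v), h⟩ = u :=
    ⟨_, fun _ _ => Iff.rfl⟩
  have hasymm : ∀ u v, D u v → ¬ D v u := by
    intro u v huv hvu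
    obtain ⟨h, hu⟩ := (hD u v).mp huv
    obtain ⟨h', hv⟩ := (hD v u).mp hvu
    have : (⟨s(u, v), h⟩ : H.edgeSet) = ⟨s(v, u), h'⟩ := Subtype.ext Sym2.eq_swap
    rw [this, hv] at hu
    exact h.ne hu.symm
  have hout : ∀ v, (Finset.univ.filter fun w => D v w).card = d := by
    intro v
    rw [← hfd v]
    refine Finset.card_bij
      (fun w hw => ⟨s(v, w), ((hD v w).mp (Finset.mem_filter.mp hw).2).1⟩) ?_ ?_ ?_
    · intro w hw
      exact Finset.mem_filter.mpr ⟨Finset.mem_univ _, ((hD v w).mp (Finset.mem_filter.mp hw).2).2⟩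
    · intro w _ w' _ h
      exact Sym2.congr_right.mp (congrArg Subtype.val h)
    · rintro ⟨e, he⟩ h
      have hv : f ⟨e, he⟩ = v := (Finset.mem_filter.mp h).2
      have hmem := hf ⟨e, he⟩
      rw [hv] at hmem
      obtain ⟨w, rfl⟩ := hmem
      exact ⟨w, Finset.mem_filter.mpr ⟨Finset.mem_univ _, (hD v w).mpr ⟨he, hv⟩⟩, rfl⟩
  refine ⟨D, fun u v h => ((hD u v).mp h).1, hasymm, hout, fun w => ?_⟩
  have hunion : H.neighborFinset w =
      (Finset.univ.filter fun v => D w v) ∪ Finset.univ.filter fun v => D v w := by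
    ext v
    simp only [SimpleGraph.mem_neighborFinset, Finset.mem_union, Finset.mem_filter,
      Finset.mem_univ, true_and]
    constructor
    · intro h
      rcases Sym2.mem_iff.mp (hf ⟨s(w, v), h⟩) with h' | h'
      · exact Or.inl ((hD w v).mpr ⟨h, h'⟩)
      · refine Or.inr ((hD v w).mpr ⟨h.symm, ?_⟩)
        have : (⟨s(v, w), h.symm⟩ : H.edgeSet) = ⟨s(w, v), h⟩ := Subtype.ext Sym2.eq_swap
        exact (congrArg f this).trans h'
    · rintro (h | h)
      exacts [((hD w v).mp h).1, ((hD v w).mp h).1.symm]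
  have hdisj : Disjoint (Finset.univ.filter fun v => D w v) (Finset.univ.filter fun v => D v w) :=
    Finset.disjoint_filter.mpr fun v _ => hasymm w v
  have := hH w
  rw [← SimpleGraph.card_neighborFinset_eq_degree, hunion, Finset.card_union_of_disjoint hdisj,
    hout] at this
  omega

end Orientation

section TwoFactors

variable {V : Type}

/-- The graph with edges `{v, σ v}`. -/
def permGraph (σ : Equiv.Perm V) : SimpleGraph V := SimpleGraph.fromRel fun u v => σ u = v

lemma neighborSet_permGraph {σ : Equiv.Perm V} {D : V → V → Prop} (hD : ∀ u v, D u v → ¬ D v u)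
    (hσ : ∀ v, D v (σ v)) (v : V) : (permGraph σ).neighborSet v = {σ v, σ.symm v} := by
  have hne : ∀ u, u ≠ σ u := fun u h => by
    have h1 := hσ u
    rw [← h] at h1
    exact hD u u h1 h1
  ext w
  simp only [permGraph, SimpleGraph.mem_neighborSet, SimpleGraph.fromRel_adj, Set.mem_insert_iff,
    Set.mem_singleton_iff, Equiv.eq_symm_apply]
  constructor
  · rintro ⟨-, h | h⟩
    exacts [Or.inl h.symm, Or.inr h]
  · rintro (rfl | rfl)
    exacts [⟨hne _, Or.inl rfl⟩, ⟨(hne _).symm, Or.inr rfl⟩]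

lemma ncard_neighborSet_permGraph {σ : Equiv.Perm V} {D : V → V → Prop}
    (hD : ∀ u v, D u v → ¬ D v u) (hσ : ∀ v, D v (σ v)) (v : V) :
    ((permGraph σ).neighborSet v).ncard = 2 := by
  rw [neighborSet_permGraph hD hσ, Set.ncard_pair]
  intro h
  have h1 := hσ (σ v)
  rw [(Equiv.eq_symm_apply σ).mp h] at h1
  exact hD _ _ (hσ v) h1

variable [Fintype V]

lemma numCycles_permGraph_le (σ : Equiv.Perm V) :
    EDHC.numCycles (permGraph σ) ≤ Nat.card (Quotient (Equiv.Perm.SameCycle.setoid σ)) := by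
  have hstep : ∀ v, (permGraph σ).Reachable v (σ v) := fun v => by
    by_cases h : v = σ v
    · rw [← h]
    · exact SimpleGraph.Adj.reachable ((SimpleGraph.fromRel_adj _ _ _).mpr ⟨h, Or.inl rfl⟩)
  have hpow : ∀ (i : ℕ) (v : V), (permGraph σ).Reachable v ((σ ^ i) v) := fun i => by
    induction i with
    | zero => exact fun v => SimpleGraph.Reachable.refl v
    | succ i ih =>
      intro v
      rw [pow_succ', Equiv.Perm.mul_apply]
      exact (ih v).trans (hstep _)
  refine Nat.card_le_card_of_surjective (Quotient.lift (permGraph σ).connectedComponentMk ?_) ?_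
  · intro u v huv
    obtain ⟨i, hi⟩ := Equiv.Perm.SameCycle.exists_nat_pow_eq huv
    rw [SimpleGraph.ConnectedComponent.eq, ← hi]
    exact hpow i u
  · intro c
    induction c using SimpleGraph.ConnectedComponent.ind with
    | _ v => exact ⟨Quotient.mk _ v, rfl⟩

/-- A `2 * d`-regular graph on `n` vertices has a 2-factor with fewer than `k` cycles as soon as the
van der Waerden lower bound for the number of permutations in a balanced orientation exceeds the
Bregman upper bound for the number of those with at least `k` cycles. -/
lemma exists_two_factor (H : SimpleGraph V) {d k : ℕ} (hd : 0 < d)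
    (hH : ∀ v, (H.neighborSet v).ncard = 2 * d)
    (hlt : ((Fintype.card V).choose k : ℝ) ^ 2 *
      Real.exp ((Fintype.card V - k : ℕ) * logRootFactorial d) <
        ((d : ℝ) / Real.exp 1) ^ Fintype.card V) :
    ∃ F ≤ H, (∀ v, (F.neighborSet v).ncard = 2) ∧ EDHC.numCycles F < k := by
  obtain ⟨D, hDH, hD, hout, hin⟩ := exists_balanced_orientation H (d := d) fun v => by
    rw [← hH v, ← SimpleGraph.card_neighborSet_eq_degree, ← Nat.card_eq_fintype_card]
    rfl
  have hlow := pow_le_card_perm D hd hout hin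
  obtain ⟨σ, hσ, hσk⟩ : ∃ σ ∈ transversals D,
      Nat.card (Quotient (Equiv.Perm.SameCycle.setoid σ)) < k := by
    by_contra! hcon
    have hup := card_transversals_le_of_cycles D (fun v => (hout v).le) hcon
    exact absurd (hlow.trans hup) (not_le.mpr hlt)
  have hσD := mem_transversals.mp hσ
  refine ⟨permGraph σ, fun u v huv => ?_, ncard_neighborSet_permGraph hD hσD,
    (numCycles_permGraph_le σ).trans_lt hσk⟩
  rcases ((SimpleGraph.fromRel_adj _ _ _).mp huv).2 with rfl | rfl
  exacts [hDH _ _ (hσD u), (hDH _ _ (hσD v)).symm]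

end TwoFactors

section Estimates

lemma log_factorial_le {d : ℕ} (hd : 0 < d) :
    Real.log d.factorial ≤ d * (Real.log d - 1) + (1 + Real.log d) := by
  induction d, hd using Nat.le_induction with
  | base => simp
  | succ d hd ih =>
    have hd' : (0 : ℝ) < d := by exact_mod_cast hd
    have h1 := Real.one_sub_inv_le_log_of_pos (x := ((d : ℝ) + 1) / d) (by positivity)
    rw [Real.log_div (by positivity) (by positivity), inv_div] at h1
    have h2 : ((d : ℝ) + 1) * (1 - d / (d + 1)) = 1 := by field_simp; ring
    have h3 := mul_le_mul_of_nonneg_left h1 (by positivity : (0 : ℝ) ≤ d + 1)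
    rw [h2] at h3
    rw [Nat.factorial_succ, Nat.cast_mul, Real.log_mul (by positivity) (by positivity)]
    push_cast
    linarith

lemma log_choose_le {n k : ℕ} (hk : 0 < k) (hkn : k ≤ n) :
    Real.log (n.choose k) ≤ k * (1 + Real.log n - Real.log k) := by
  have hk' : (0 : ℝ) < k := by exact_mod_cast hk
  have hn' : (0 : ℝ) < n := by exact_mod_cast hk.trans_le hkn
  have hf : (0 : ℝ) < k.factorial := by exact_mod_cast k.factorial_pos
  have hC : (0 : ℝ) < n.choose k := by exact_mod_cast Nat.choose_pos hkn
  have h1 := Real.log_le_log hC (Nat.choose_le_pow_div (α := ℝ) k n)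
  have h2 := Real.log_le_log (by positivity) (Real.pow_div_factorial_le_exp (k : ℝ) hk'.le k)
  rw [Real.log_div (by positivity) (by positivity), Real.log_pow] at h1 h2
  rw [Real.log_exp] at h2
  linarith

lemma choose_sq_mul_exp_lt {n d k : ℕ} (hL : Real.exp 4 ≤ Real.log n) (hd : Real.log n ^ 2 ≤ d)
    (hdn : d ≤ n) (hk : 4 * Real.log n * (n : ℝ) ^ 2 ≤ (k : ℝ) ^ 2 * d) :
    (n.choose k : ℝ) ^ 2 * Real.exp ((n - k : ℕ) * logRootFactorial d) <
      ((d : ℝ) / Real.exp 1) ^ n := by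
  have hexp : (5 : ℝ) ≤ Real.exp 4 := by linarith [Real.add_one_le_exp (4 : ℝ)]
  set L := Real.log n with hLdef
  have hL5 : 5 ≤ L := hexp.trans hL
  have hn : (0 : ℝ) < n := by
    rcases Nat.eq_zero_or_pos n with rfl | h
    · simp at hLdef; linarith
    · exact_mod_cast h
  have hLd : L ≤ d := by nlinarith
  have hd0 : (0 : ℝ) < d := by linarith
  have hdpos : 0 < d := by exact_mod_cast hd0
  have hk0 : 0 < k := by
    rcases Nat.eq_zero_or_pos k with rfl | h
    · have : 0 < 4 * L * (n : ℝ) ^ 2 := by positivity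
      norm_num at hk
      linarith
    · exact h
  have hk0' : (0 : ℝ) < k := by exact_mod_cast hk0
  rcases lt_or_ge n k with hnk | hkn
  · rw [Nat.choose_eq_zero_of_lt hnk]
    norm_num
    positivity
  have hC : (0 : ℝ) < n.choose k := by exact_mod_cast Nat.choose_pos hkn
  rw [← Real.log_lt_log_iff (by positivity) (by positivity), Real.log_mul (by positivity)
    (by positivity), Real.log_pow, Real.log_exp, Real.log_pow, Real.log_div hd0.ne' (by positivity),
    Real.log_exp, Nat.cast_sub hkn]
  have h1 := log_choose_le hk0 hkn
  set ℓ := Real.log d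
  have hℓ0 : 0 ≤ ℓ := Real.log_nonneg (by linarith)
  have hℓL : ℓ ≤ L := Real.log_le_log hd0 (by exact_mod_cast hdn)
  have hg : logRootFactorial d ≤ (ℓ - 1) + (1 + ℓ) / d := by
    rw [logRootFactorial, div_le_iff₀ hd0]
    calc _ ≤ _ := log_factorial_le hdpos
      _ = _ := by field_simp; rfl
  have hnk : (0 : ℝ) ≤ n - k := by
    have : (k : ℝ) ≤ n := by exact_mod_cast hkn
    linarith
  have h2 : ((n : ℝ) - k) * logRootFactorial d ≤ (n - k) * (ℓ - 1) + n * ((1 + ℓ) / d) := by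
    calc _ ≤ ((n : ℝ) - k) * ((ℓ - 1) + (1 + ℓ) / d) := by gcongr
      _ = (n - k) * (ℓ - 1) + (n - k) * ((1 + ℓ) / d) := by ring
      _ ≤ _ := by gcongr; linarith
  have h3 : 4 + 2 * L ≤ 2 * Real.log k + ℓ := by
    have h4 := Real.log_le_log (by positivity) hk
    rw [Real.log_mul (by positivity) (by positivity), Real.log_mul (by positivity) (by positivity),
      Real.log_pow, Real.log_mul (by positivity) (by positivity), Real.log_pow] at h4
    have h5 : 4 ≤ Real.log L := (Real.le_log_iff_exp_le (by linarith)).mpr hL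
    have h6 : 0 ≤ Real.log 4 := Real.log_nonneg (by norm_num)
    push_cast at h4
    linarith
  have h7 : n * ((1 + ℓ) / d) < k := by
    rw [mul_div_assoc', div_lt_iff₀ hd0]
    refine lt_of_pow_lt_pow_left₀ 2 (by positivity) ?_
    calc ((n : ℝ) * (1 + ℓ)) ^ 2 = (1 + ℓ) ^ 2 * (n : ℝ) ^ 2 := by ring
      _ < (4 * L * d) * (n : ℝ) ^ 2 := by
        gcongr
        calc (1 + ℓ) ^ 2 < (2 * L) ^ 2 := by gcongr; linarith
          _ = 4 * L * L := by ring
          _ ≤ _ := by gcongr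
      _ = d * (4 * L * (n : ℝ) ^ 2) := by ring
      _ ≤ d * ((k : ℝ) ^ 2 * d) := by gcongr
      _ = (k * d) ^ 2 := by ring
  have h8 : (k : ℝ) * (1 + L - Real.log k) * 2 ≤ k * (ℓ - 2) := by
    calc _ = (k : ℝ) * ((1 + L - Real.log k) * 2) := by ring
      _ ≤ _ := by gcongr; linarith
  push_cast
  linarith

end Estimates

end TwoFactor

open EDHC in
/-- Lemma 6.4 (Simple2Fac): a 2-factor with few cycles. -/
theorem stmt_13 :
    ∃ N : ℕ, ∀ n : ℕ, N ≤ n →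
      ∀ (rG : ℝ) (G H : SimpleGraph (Fin n)) (rH : ℕ),
      (Real.log n) ^ 2 ≤ rG → IsPseudorandom n G (rG / n) →
      Even rH → 2 * Real.sqrt rG * Real.log n ≤ (rH : ℝ) →
      H ≤ G → (∀ v, deg H v = rH) →
      ∃ F : SimpleGraph (Fin n), F ≤ H ∧ (∀ v, deg F v = 2) ∧
        (numCycles F : ℝ) ≤ 4 * (n : ℝ) * Real.sqrt (rG * Real.log n) / (rH : ℝ) := by
  refine ⟨⌈Real.exp (Real.exp 4)⌉₊, ?_⟩
  intro n hn rG G H rH hrG hG hev hrH hHG hH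
  have hn' : Real.exp (Real.exp 4) ≤ n := Nat.ceil_le.mp hn
  have hn0 : (0 : ℝ) < n := (Real.exp_pos _).trans_le hn'
  have hL : Real.exp 4 ≤ Real.log n := (Real.le_log_iff_exp_le hn0).mpr hn'
  have hexp : (5 : ℝ) ≤ Real.exp 4 := by linarith [Real.add_one_le_exp (4 : ℝ)]
  set L := Real.log n
  have hL5 : 5 ≤ L := hexp.trans hL
  have hrG0 : 0 < rG := by nlinarith
  have hsq : L ≤ Real.sqrt rG := Real.le_sqrt_of_sq_le hrG
  obtain ⟨d, rfl⟩ := hev.two_dvd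
  have hdL : L ^ 2 ≤ (d : ℝ) := by
    have : 2 * L * L ≤ 2 * Real.sqrt rG * L := by gcongr
    push_cast at hrH
    nlinarith
  have hd0 : (0 : ℝ) < d := by nlinarith
  have hdpos : 0 < d := by exact_mod_cast hd0
  let v : Fin n := ⟨0, by exact_mod_cast hn0⟩
  have hdegG : 2 * d ≤ deg G v := by
    rw [← hH v]
    exact Set.ncard_le_ncard (fun w hw => hHG hw) (Set.toFinite _)
  have hdn : d ≤ n := by
    have h1 : deg G v ≤ n := by
      have := Set.ncard_le_ncard (Set.subset_univ (G.neighborSet v)) (Set.toFinite _)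
      simpa [deg, Set.ncard_univ] using this
    omega
  have hmax : deg G v ≤ maxDeg G := le_csSup (Set.finite_range _).bddAbove ⟨v, rfl⟩
  have hΔ : (maxDeg G : ℝ) ≤ rG + 2 * Real.sqrt (rG * L) := by
    have := hG.2.2.2.1.2.2
    rwa [mul_div_cancel₀ _ hn0.ne'] at this
  have hdrG : (d : ℝ) ≤ rG := by
    have h1 : ((2 * d : ℕ) : ℝ) ≤ maxDeg G := by exact_mod_cast hdegG.trans hmax
    have h2 : Real.sqrt (rG * L) ≤ rG / 2 := by
      rw [Real.sqrt_le_left (by positivity)]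
      nlinarith
    push_cast at h1
    linarith
  set K := 4 * (n : ℝ) * Real.sqrt (rG * L) / ((2 * d : ℕ) : ℝ) with hK
  have hK0 : 0 ≤ K := by positivity
  have hK2 : 4 * L * (n : ℝ) ^ 2 ≤ K ^ 2 * d := by
    have : K ^ 2 * d = 4 * L * (n : ℝ) ^ 2 * (rG / d) := by
      rw [hK, div_pow, mul_pow, Real.sq_sqrt (by positivity)]
      push_cast
      field_simp
      norm_num
    rw [this]
    exact le_mul_of_one_le_right (by positivity) ((one_le_div hd0).mpr hdrG)
  have hk : 4 * L * (n : ℝ) ^ 2 ≤ ((⌊K⌋₊ + 1 : ℕ) : ℝ) ^ 2 * d := by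
    refine hK2.trans ?_
    have := (Nat.lt_floor_add_one K).le
    push_cast
    gcongr
  obtain ⟨F, hFH, hF, hFk⟩ := TwoFactor.exists_two_factor H (d := d) (k := ⌊K⌋₊ + 1) hdpos hH
    (by rw [Fintype.card_fin]; exact TwoFactor.choose_sq_mul_exp_lt hL hdL hdn hk)
  exact ⟨F, hFH, hF, (Nat.le_floor_iff hK0).mp (Nat.lt_succ_iff.mp hFk)⟩
end
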